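/- Fix d \ge 1, T > 0, p \in [1,\infty], an integer r > 0, and \nu < 0 with \nu > -2(1 - 1/p). Let \xi be a periodic distribution defined on the set of test functions whose supports lie in ((-\infty,0)\cup(0,T))\times\mathbb{R}^d, such that \langle\xi,\varphi\rangle = 0 whenever supp\,\varphi \subseteq (-\infty,0)\times\mathbb{R}^d, and such that \sup_{\lambda\in(0,1]} \| \sup_{\varphi\in\mathscr{B}^r} |\langle\xi,\varphi^\lambda_z\rangle|\,\lambda^{-\nu} \|_{L^p((3\lambda^2,\,T-\lambda^2)\times\mathbb{T}^d,\,dz)} < \infty. Then \xi admits a unique extension to a distribution acting on all test functions supported in (-\infty,T)\times\mathbb{R}^d which belongs to \mathcal{B}^{\nu,T}_p. -/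

import Mathlib

open MeasureTheory Filter Topology

noncomputable section

/-- Parabolic scaling exponents s = (2,1,…,1) on ℝ^(1+d). -/
def sE (d : ℕ) : Fin (d + 1) → ℕ := Fin.cons 2 (fun _ => 1)

/-- Parabolically scaled norm |z|_s = max_i |z_i|^(1/s_i). -/
def snormE (d : ℕ) (z : Fin (d + 1) → ℝ) : ℝ := ⨆ i, |z i| ^ ((sE d i : ℝ)⁻¹)

/-- Scaling action l · z = (l^(s_i) z_i)_i. -/
def sclE (d : ℕ) (l : ℝ) (z : Fin (d + 1) → ℝ) : Fin (d + 1) → ℝ :=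
  fun i => l ^ (sE d i) * z i

/-- Rescaled and recentred test function φ^λ_z(y) = λ^(-|s|) φ(λ⁻¹ · (y - z)),
with |s| = d + 2. -/
def testScale (d : ℕ) (l : ℝ) (z : Fin (d + 1) → ℝ) (φ : (Fin (d + 1) → ℝ) → ℝ) :
    (Fin (d + 1) → ℝ) → ℝ :=
  fun y => (l ^ (d + 2))⁻¹ * φ (sclE d l⁻¹ (y - z))

/-- Scaled size |k|_s = ∑ s_i k_i of a multi-index. -/
def ksizeE (d : ℕ) (k : Fin (d + 1) → ℕ) : ℝ := ∑ i, (sE d i : ℝ) * (k i : ℝ)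

/-- Partial derivative in direction i. -/
def pdE (d : ℕ) (i : Fin (d + 1)) (f : (Fin (d + 1) → ℝ) → ℝ) :
    (Fin (d + 1) → ℝ) → ℝ :=
  fun z => fderiv ℝ f z (Pi.single i 1)

/-- Iterated partial derivative ∂^k. -/
def pdME (d : ℕ) (k : Fin (d + 1) → ℕ) (f : (Fin (d + 1) → ℝ) → ℝ) :
    (Fin (d + 1) → ℝ) → ℝ :=
  ((List.ofFn (fun i : Fin (d + 1) => (pdE d i)^[k i])).foldr (· ∘ ·) id) f

/-- The class 𝓑^r: C^r functions supported in the scaled unit ball whose scaled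
derivatives of order < r are bounded by 1. -/
def BrSet (d r : ℕ) : Set ((Fin (d + 1) → ℝ) → ℝ) :=
  {φ | tsupport φ ⊆ {y | snormE d y ≤ 1} ∧ ContDiff ℝ (r : ℕ∞) φ ∧
    ∀ k : Fin (d + 1) → ℕ, ksizeE d k < r → ∀ y, |pdME d k φ y| ≤ 1}

/-- A test function of class C^r, compactly supported, with support contained in S. -/
def IsTest (d r : ℕ) (S : Set (Fin (d + 1) → ℝ)) (φ : (Fin (d + 1) → ℝ) → ℝ) : Prop :=
  ContDiff ℝ (r : ℕ∞) φ ∧ HasCompactSupport φ ∧ tsupport φ ⊆ S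

/-- ξ is linear on test functions supported in S. -/
def LinOn (d r : ℕ) (S : Set (Fin (d + 1) → ℝ))
    (ξ : ((Fin (d + 1) → ℝ) → ℝ) → ℝ) : Prop :=
  (∀ φ ψ, IsTest d r S φ → IsTest d r S ψ → ξ (φ + ψ) = ξ φ + ξ ψ) ∧
  (∀ (c : ℝ) φ, IsTest d r S φ → ξ (c • φ) = c * ξ φ)

/-- ξ is periodic: invariant under integer translations in the space variables. -/
def PeriodicOn (d r : ℕ) (S : Set (Fin (d + 1) → ℝ))
    (ξ : ((Fin (d + 1) → ℝ) → ℝ) → ℝ) : Prop :=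
  ∀ (m : Fin d → ℤ) (φ : (Fin (d + 1) → ℝ) → ℝ), IsTest d r S φ →
    ξ (fun y => φ (y - Fin.cons (0 : ℝ) (fun i => (m i : ℝ)))) = ξ φ

/-- The strip I × 𝕋^d, realized as time coordinate in I and space coordinates in a
fundamental domain [0,1)^d. -/
def strip (d : ℕ) (I : Set ℝ) : Set (Fin (d + 1) → ℝ) :=
  {z | z 0 ∈ I ∧ ∀ i : Fin d, z i.succ ∈ Set.Ico (0 : ℝ) 1}

/-- L^p norm (p ∈ [1,∞]) of an ℝ≥0∞-valued function. -/
def lpE (d : ℕ) (μ : Measure (Fin (d + 1) → ℝ)) (p : ENNReal)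
    (g : (Fin (d + 1) → ℝ) → ENNReal) : ENNReal :=
  if p = ⊤ then essSup g μ else (∫⁻ z, g z ^ p.toReal ∂μ) ^ (1 / p.toReal)

/-- The region ((-∞,0) ∪ (0,T)) × ℝ^d. -/
def S0 (d : ℕ) (T : ℝ) : Set (Fin (d + 1) → ℝ) :=
  {z | z 0 < 0 ∨ (0 < z 0 ∧ z 0 < T)}

/-- The region (-∞,T) × ℝ^d. -/
def S1 (d : ℕ) (T : ℝ) : Set (Fin (d + 1) → ℝ) :=
  {z | z 0 < T}

/-- The weighted L^p quantity appearing in the definition of the space 𝓑^(ν,T)_p: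
the L^p norm over z ∈ J × 𝕋^d of λ^(-ν) sup_(φ ∈ 𝓑^r) |ξ(φ^λ_z)|. -/
def bNorm (d r : ℕ) (p : ENNReal) (ν : ℝ) (ξ : ((Fin (d + 1) → ℝ) → ℝ) → ℝ)
    (l : ℝ) (J : Set ℝ) : ENNReal :=
  lpE d (volume.restrict (strip d J)) p
    (fun z => ENNReal.ofReal (l ^ (-ν)) *
      ⨆ φ ∈ BrSet d r, ENNReal.ofReal |ξ (testScale d l z φ)|)

/-- Membership in 𝓑^(ν,T)_p (for ν < 0): periodicity together with finiteness of the
supremum over λ ∈ (0,1] of the weighted L^p norms over (-∞, T-λ²) × 𝕋^d. -/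
def MemBnu (d r : ℕ) (p : ENNReal) (ν T : ℝ)
    (ξ : ((Fin (d + 1) → ℝ) → ℝ) → ℝ) : Prop :=
  PeriodicOn d r (S1 d T) ξ ∧
  (⨆ l ∈ Set.Ioc (0 : ℝ) 1, bNorm d r p ν ξ l (Set.Iio (T - l ^ 2))) < ⊤


/-- Iterated partial derivative along a list of directions, the last one applied first. -/
def wordDeriv (d : ℕ) (w : List (Fin (d + 1))) (f : (Fin (d + 1) → ℝ) → ℝ) :
    (Fin (d + 1) → ℝ) → ℝ :=
  w.foldr (pdE d) f

/-- Parabolic weight of a list of directions. -/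
def wordWeight (d : ℕ) (w : List (Fin (d + 1))) : ℕ := (w.map (sE d)).sum

/-- The increasing list of directions representing a multi-index. -/
def sortedWord (d : ℕ) (k : Fin (d + 1) → ℕ) : List (Fin (d + 1)) :=
  (List.ofFn fun i => List.replicate (k i) i).flatten

lemma one_le_sE (d : ℕ) (i : Fin (d + 1)) : 1 ≤ sE d i := by
  refine Fin.cases ?_ (fun j => ?_) i <;> simp [sE]

lemma sE_zero (d : ℕ) : sE d 0 = 2 := rfl

lemma sE_succ (d : ℕ) (i : Fin d) : sE d i.succ = 1 := rfl

lemma sum_sE (d : ℕ) : ∑ i, sE d i = d + 2 := by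
  rw [Fin.sum_univ_succ]; simp [sE_zero, sE_succ]; ring

lemma pdME_eq_wordDeriv (d : ℕ) (k : Fin (d + 1) → ℕ) (f : (Fin (d + 1) → ℝ) → ℝ) :
    pdME d k f = wordDeriv d (sortedWord d k) f := by
  have key : ∀ L : List (Fin (d + 1)),
      ((L.map fun i => (pdE d i)^[k i]).foldr (· ∘ ·) id) f
        = ((L.map fun i => List.replicate (k i) i).flatten).foldr (pdE d) f := by
    intro L
    induction L with
    | nil => rfl
    | cons a L ih =>
      simp only [List.map_cons, List.foldr_cons, Function.comp_apply, List.flatten_cons,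
        List.foldr_append, ih]
      generalize List.foldr (pdE d) f _ = g
      induction k a with
      | zero => rfl
      | succ n ihn => rw [Function.iterate_succ_apply', ihn]; rfl
  unfold pdME wordDeriv sortedWord
  rw [List.ofFn_eq_map, List.ofFn_eq_map]
  exact key _

lemma wordWeight_sortedWord (d : ℕ) (k : Fin (d + 1) → ℕ) :
    (wordWeight d (sortedWord d k) : ℝ) = ksizeE d k := by
  have key : ∀ L : List (Fin (d + 1)),
      wordWeight d ((L.map fun i => List.replicate (k i) i).flatten)
        = (L.map fun i => sE d i * k i).sum := by
    intro L
    induction L with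
    | nil => rfl
    | cons a L ih =>
      simp only [List.map_cons, List.flatten_cons, List.sum_cons, ← ih, wordWeight,
        List.map_append, List.sum_append, List.map_replicate, List.sum_replicate, smul_eq_mul]
      ring
  unfold sortedWord ksizeE
  rw [List.ofFn_eq_map, key, ← List.ofFn_eq_map, List.sum_ofFn]
  push_cast
  rfl

lemma pairwise_sortedWord (d : ℕ) (k : Fin (d + 1) → ℕ) :
    (sortedWord d k).Pairwise (· ≤ ·) := by
  rw [sortedWord, List.pairwise_flatten]
  constructor
  · intro l hl
    obtain ⟨i, rfl⟩ := (List.mem_ofFn' _ _).1 hl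
    exact List.pairwise_replicate.2 (Or.inr le_rfl)
  · rw [List.pairwise_ofFn]
    intro i j hij x hx y hy
    rw [List.eq_of_mem_replicate hx, List.eq_of_mem_replicate hy]
    exact hij.le

lemma exists_eq_sortedWord (d : ℕ) (w : List (Fin (d + 1))) (hw : w.Pairwise (· ≤ ·)) :
    ∃ k, w = sortedWord d k := by
  refine ⟨fun i => w.count i, ?_⟩
  refine List.Perm.eq_of_pairwise (le := (· ≤ ·)) (fun a b _ _ h h' => le_antisymm h h') hw
    (pairwise_sortedWord d _) ?_
  rw [List.perm_iff_count]
  intro a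
  rw [sortedWord, List.count_flatten, List.map_ofFn, List.sum_ofFn]
  simp [List.count_replicate]

lemma length_le_wordWeight (d : ℕ) (w : List (Fin (d + 1))) : w.length ≤ wordWeight d w := by
  induction w with
  | nil => simp
  | cons a w ih =>
    have := one_le_sE d a
    simp only [wordWeight, List.map_cons, List.sum_cons, List.length_cons] at ih ⊢
    omega

lemma wordWeight_append (d : ℕ) (u v : List (Fin (d + 1))) :
    wordWeight d (u ++ v) = wordWeight d u + wordWeight d v := by
  simp [wordWeight]

lemma wordWeight_singleton (d : ℕ) (i : Fin (d + 1)) : wordWeight d [i] = sE d i := by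
  simp [wordWeight]

lemma wordWeight_le_of_sublist (d : ℕ) {u v : List (Fin (d + 1))} (h : u.Sublist v) :
    wordWeight d u ≤ wordWeight d v :=
  (h.map _).sum_le_sum (by simp)

lemma wordDeriv_append (d : ℕ) (u v : List (Fin (d + 1))) (f : (Fin (d + 1) → ℝ) → ℝ) :
    wordDeriv d (u ++ v) f = wordDeriv d u (wordDeriv d v f) := by
  simp [wordDeriv]

lemma wordDeriv_singleton (d : ℕ) (i : Fin (d + 1)) (f : (Fin (d + 1) → ℝ) → ℝ) :
    wordDeriv d [i] f = pdE d i f := rfl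

lemma wordDeriv_cons (d : ℕ) (i : Fin (d + 1)) (w) (f : (Fin (d + 1) → ℝ) → ℝ) :
    wordDeriv d (i :: w) f = pdE d i (wordDeriv d w f) := rfl

lemma contDiff_pdE {d : ℕ} {n : ℕ} (i : Fin (d + 1)) {f : (Fin (d + 1) → ℝ) → ℝ}
    (hf : ContDiff ℝ ((n + 1 : ℕ) : ℕ∞) f) : ContDiff ℝ (n : ℕ∞) (pdE d i f) := by
  have : ContDiff ℝ (n : ℕ∞) (fderiv ℝ f) := hf.fderiv_right (by norm_cast)
  exact this.clm_apply contDiff_const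

lemma differentiable_of_contDiff_succ {d : ℕ} {n : ℕ} {f : (Fin (d + 1) → ℝ) → ℝ}
    (hf : ContDiff ℝ ((n + 1 : ℕ) : ℕ∞) f) : Differentiable ℝ f :=
  hf.differentiable (by norm_cast)

lemma contDiff_wordDeriv {d : ℕ} (w : List (Fin (d + 1))) {n : ℕ} {f : (Fin (d + 1) → ℝ) → ℝ}
    (hf : ContDiff ℝ ((n + w.length : ℕ) : ℕ∞) f) : ContDiff ℝ (n : ℕ∞) (wordDeriv d w f) := by
  induction w generalizing n with
  | nil => exact hf
  | cons i w ih =>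
    refine contDiff_pdE i (ih ?_)
    convert hf using 3
    simp; ring

lemma pdE_add {d : ℕ} (i : Fin (d + 1)) {f g : (Fin (d + 1) → ℝ) → ℝ}
    (hf : Differentiable ℝ f) (hg : Differentiable ℝ g) :
    pdE d i (f + g) = pdE d i f + pdE d i g := by
  ext y
  simp [pdE, fderiv_add (hf y) (hg y)]

lemma pdE_const_mul {d : ℕ} (i : Fin (d + 1)) (c : ℝ) {f : (Fin (d + 1) → ℝ) → ℝ}
    (hf : Differentiable ℝ f) :
    pdE d i (fun y => c * f y) = fun y => c * pdE d i f y := by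
  ext y
  simp [pdE, fderiv_const_mul (hf y)]

lemma pdE_mul {d : ℕ} (i : Fin (d + 1)) {f g : (Fin (d + 1) → ℝ) → ℝ}
    (hf : Differentiable ℝ f) (hg : Differentiable ℝ g) :
    pdE d i (f * g) = pdE d i f * g + f * pdE d i g := by
  ext y
  simp [pdE, fderiv_mul (hf y) (hg y)]
  ring

lemma wordDeriv_add {d : ℕ} (w : List (Fin (d + 1))) {f g : (Fin (d + 1) → ℝ) → ℝ}
    (hf : ContDiff ℝ (w.length : ℕ∞) f) (hg : ContDiff ℝ (w.length : ℕ∞) g) :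
    wordDeriv d w (f + g) = wordDeriv d w f + wordDeriv d w g := by
  induction w with
  | nil => rfl
  | cons i w ih =>
    have hf' : ContDiff ℝ ((1 + w.length : ℕ) : ℕ∞) f := by simpa [add_comm] using hf
    have hg' : ContDiff ℝ ((1 + w.length : ℕ) : ℕ∞) g := by simpa [add_comm] using hg
    rw [wordDeriv_cons, ih (hf.of_le (by simp)) (hg.of_le (by simp)),
      pdE_add i (differentiable_of_contDiff_succ (n := 0) (contDiff_wordDeriv w hf'))
        (differentiable_of_contDiff_succ (n := 0) (contDiff_wordDeriv w hg'))]
    rfl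

lemma wordDeriv_const_mul {d : ℕ} (w : List (Fin (d + 1))) (c : ℝ) {f : (Fin (d + 1) → ℝ) → ℝ}
    (hf : ContDiff ℝ (w.length : ℕ∞) f) :
    wordDeriv d w (fun y => c * f y) = fun y => c * wordDeriv d w f y := by
  induction w with
  | nil => rfl
  | cons i w ih =>
    have hf' : ContDiff ℝ ((1 + w.length : ℕ) : ℕ∞) f := by simpa [add_comm] using hf
    rw [wordDeriv_cons, ih (hf.of_le (by simp)),
      pdE_const_mul i c (differentiable_of_contDiff_succ (n := 0) (contDiff_wordDeriv w hf'))]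
    rfl

lemma abs_wordDeriv_mul_le {d : ℕ} (w : List (Fin (d + 1))) {f g : (Fin (d + 1) → ℝ) → ℝ}
    {A B l : ℝ} (hl : 0 < l)
    (hf : ContDiff ℝ (w.length : ℕ∞) f) (hg : ContDiff ℝ (w.length : ℕ∞) g)
    (hA : ∀ u : List (Fin (d + 1)), u.Sublist w → ∀ y,
      |wordDeriv d u f y| * l ^ wordWeight d u ≤ A)
    (hB : ∀ u : List (Fin (d + 1)), u.Sublist w → ∀ y,
      |wordDeriv d u g y| * l ^ wordWeight d u ≤ B) (y : Fin (d + 1) → ℝ) :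
    |wordDeriv d w (f * g) y| * l ^ wordWeight d w ≤ 2 ^ w.length * (A * B) := by
  induction w using List.reverseRecOn generalizing f g A B with
  | nil =>
    have h1 := hA [] (List.Sublist.refl _) y
    have h2 := hB [] (List.Sublist.refl _) y
    simp only [wordDeriv, List.foldr_nil, wordWeight, List.map_nil, List.sum_nil, pow_zero,
      mul_one, List.length_nil, one_mul, Pi.mul_apply, abs_mul] at h1 h2 ⊢
    exact mul_le_mul h1 h2 (abs_nonneg _) ((abs_nonneg _).trans h1)
  | append_singleton w i ih =>
    have hf1 : ContDiff ℝ ((w.length + 1 : ℕ) : ℕ∞) f := by simpa using hf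
    have hg1 : ContDiff ℝ ((w.length + 1 : ℕ) : ℕ∞) g := by simpa using hg
    have hf0 : ContDiff ℝ (w.length : ℕ∞) f := hf1.of_le (by norm_cast; omega)
    have hg0 : ContDiff ℝ (w.length : ℕ∞) g := hg1.of_le (by norm_cast; omega)
    have hfi := contDiff_pdE i hf1
    have hgi := contDiff_pdE i hg1
    have hli : 0 < l ^ sE d i := pow_pos hl _
    have ext : ∀ {h : (Fin (d + 1) → ℝ) → ℝ} {D : ℝ},
        (∀ u : List (Fin (d + 1)), u.Sublist (w ++ [i]) → ∀ y,
          |wordDeriv d u h y| * l ^ wordWeight d u ≤ D) →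
        (∀ u : List (Fin (d + 1)), u.Sublist w → ∀ y,
          |wordDeriv d u (pdE d i h) y| * l ^ wordWeight d u ≤ D / l ^ sE d i) := by
      intro h D hD u hu y
      have := hD (u ++ [i]) (hu.append (List.Sublist.refl _)) y
      rw [wordDeriv_append, wordDeriv_singleton, wordWeight_append, wordWeight_singleton,
        pow_add, ← mul_assoc] at this
      rwa [le_div_iff₀ hli]
    have low : ∀ {h : (Fin (d + 1) → ℝ) → ℝ} {D : ℝ},
        (∀ u : List (Fin (d + 1)), u.Sublist (w ++ [i]) → ∀ y,
          |wordDeriv d u h y| * l ^ wordWeight d u ≤ D) →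
        (∀ u : List (Fin (d + 1)), u.Sublist w → ∀ y,
          |wordDeriv d u h y| * l ^ wordWeight d u ≤ D) := fun hD u hu y =>
      hD u (hu.trans (List.sublist_append_left _ _)) y
    have e1 := ih hfi hg0 (ext hA) (low hB)
    have e2 := ih hf0 hgi (low hA) (ext hB)
    rw [wordDeriv_append, wordDeriv_singleton,
      pdE_mul i (differentiable_of_contDiff_succ hf1) (differentiable_of_contDiff_succ hg1),
      wordDeriv_add w (f := pdE d i f * g) (g := f * pdE d i g) (hfi.mul hg0) (hf0.mul hgi),
      wordWeight_append, wordWeight_singleton, pow_add,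
      ← mul_assoc, ← le_div_iff₀ hli]
    calc |(wordDeriv d w (pdE d i f * g) + wordDeriv d w (f * pdE d i g)) y| * l ^ wordWeight d w
        ≤ (|wordDeriv d w (pdE d i f * g) y| + |wordDeriv d w (f * pdE d i g) y|)
            * l ^ wordWeight d w := by
          gcongr
          exact abs_add_le _ _
      _ ≤ 2 ^ w.length * (A / l ^ sE d i * B) + 2 ^ w.length * (A * (B / l ^ sE d i)) := by
          rw [add_mul]; exact add_le_add e1 e2
      _ = 2 ^ (w ++ [i]).length * (A * B) / l ^ sE d i := by
          simp only [List.length_append, List.length_singleton, pow_succ]; ring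

lemma pdE_comp_affine {d : ℕ} (i : Fin (d + 1)) (l : ℝ) (z : Fin (d + 1) → ℝ)
    {f : (Fin (d + 1) → ℝ) → ℝ} (hf : Differentiable ℝ f) :
    pdE d i (fun y => f (z + sclE d l y)) = fun y => l ^ sE d i * pdE d i f (z + sclE d l y) := by
  ext y
  let A : (Fin (d + 1) → ℝ) →L[ℝ] (Fin (d + 1) → ℝ) :=
    ContinuousLinearMap.pi fun j => (l ^ sE d j) • ContinuousLinearMap.proj j
  have hA : HasFDerivAt (fun y => z + sclE d l y) A y := by
    have : HasFDerivAt (fun y => z + A y) A y := A.hasFDerivAt.const_add z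
    exact this
  have h := ((hf (z + sclE d l y)).hasFDerivAt.comp y hA).fderiv
  have h2 : A (Pi.single i 1) = (l ^ sE d i) • Pi.single i (1 : ℝ) := by
    ext j
    by_cases hj : j = i
    · subst hj; simp [A]
    · simp [A, hj]
  simp only [pdE]
  rw [show (fun y => f (z + sclE d l y)) = f ∘ (fun y => z + sclE d l y) from rfl, h]
  simp [h2]

lemma contDiff_affine {d : ℕ} (l : ℝ) (z : Fin (d + 1) → ℝ) {n : WithTop ℕ∞} :
    ContDiff ℝ n (fun y => z + sclE d l y) := by
  refine contDiff_const.add ?_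
  rw [contDiff_pi]
  intro i
  exact contDiff_const.mul (contDiff_apply ℝ ℝ i)

lemma wordDeriv_comp_affine {d : ℕ} (w : List (Fin (d + 1))) (l : ℝ) (z : Fin (d + 1) → ℝ)
    {f : (Fin (d + 1) → ℝ) → ℝ} (hf : ContDiff ℝ (w.length : ℕ∞) f) :
    wordDeriv d w (fun y => f (z + sclE d l y))
      = fun y => l ^ wordWeight d w * wordDeriv d w f (z + sclE d l y) := by
  induction w with
  | nil => ext y; simp [wordDeriv, wordWeight]
  | cons i w ih =>
    have hf' : ContDiff ℝ ((1 + w.length : ℕ) : ℕ∞) f := by simpa [add_comm] using hf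
    have hd : ContDiff ℝ ((1 : ℕ) : ℕ∞) (wordDeriv d w f) := contDiff_wordDeriv w hf'
    have hD : Differentiable ℝ (wordDeriv d w f) := differentiable_of_contDiff_succ (n := 0) hd
    have hD' : Differentiable ℝ (fun y => wordDeriv d w f (z + sclE d l y)) :=
      hD.comp ((contDiff_affine l z (n := 1)).differentiable one_ne_zero)
    rw [wordDeriv_cons, ih (hf.of_le (by simp)), pdE_const_mul i _ hD', pdE_comp_affine i l z hD]
    ext y
    simp only [wordWeight, List.map_cons, List.sum_cons, pow_add, wordDeriv_cons]
    ring

lemma wordDeriv_zero (d : ℕ) (w : List (Fin (d + 1))) : wordDeriv d w (fun _ => 0) = fun _ => 0 := by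
  induction w with
  | nil => rfl
  | cons i w ih => rw [wordDeriv_cons, ih]; ext y; simp [pdE]

lemma hasCompactSupport_wordDeriv {d : ℕ} (w : List (Fin (d + 1))) {f : (Fin (d + 1) → ℝ) → ℝ}
    (hf : HasCompactSupport f) : HasCompactSupport (wordDeriv d w f) := by
  induction w with
  | nil => exact hf
  | cons i w ih => exact ih.fderiv_apply (𝕜 := ℝ) _

/-- Bounds on the derivatives of parabolic order less than `r`, measured at scale `l`. -/
def DerivBound (d r : ℕ) (l A : ℝ) (f : (Fin (d + 1) → ℝ) → ℝ) : Prop :=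
  ∀ w : List (Fin (d + 1)), w.Pairwise (· ≤ ·) → wordWeight d w < r →
    ∀ y, |wordDeriv d w f y| * l ^ wordWeight d w ≤ A

lemma mem_BrSet_iff {d r : ℕ} {φ : (Fin (d + 1) → ℝ) → ℝ} :
    φ ∈ BrSet d r ↔ (∀ y ∈ tsupport φ, ∀ i, |y i| ≤ 1) ∧ ContDiff ℝ (r : ℕ∞) φ ∧
      DerivBound d r 1 1 φ := by
  have h1 : ∀ y : Fin (d + 1) → ℝ, snormE d y ≤ 1 ↔ ∀ i, |y i| ≤ 1 := by
    intro y
    unfold snormE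
    rw [ciSup_le_iff (Set.finite_range _).bddAbove]
    refine forall_congr' fun i => ?_
    have : (0 : ℝ) < (sE d i : ℝ)⁻¹ := by
      have := one_le_sE d i
      positivity
    constructor
    · intro h
      by_contra! hc
      exact absurd h (not_le.2 (Real.one_lt_rpow hc this))
    · intro h
      exact Real.rpow_le_one (abs_nonneg _) h this.le
  unfold BrSet
  simp only [Set.mem_ofPred_eq]
  refine and_congr ?_ (and_congr_right fun _ => ?_)
  · exact ⟨fun h y hy => (h1 y).1 (h hy), fun h y hy => (h1 y).2 (h y hy)⟩
  · constructor
    · intro h w hw hr y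
      obtain ⟨k, rfl⟩ := exists_eq_sortedWord d w hw
      rw [← pdME_eq_wordDeriv, one_pow, mul_one]
      exact h k (by rw [← wordWeight_sortedWord]; exact_mod_cast hr) y
    · intro h k hk y
      have := h _ (pairwise_sortedWord d k)
        (by rw [← wordWeight_sortedWord] at hk; exact_mod_cast hk) y
      rwa [one_pow, mul_one, ← pdME_eq_wordDeriv] at this

lemma DerivBound.mono_scale {d r : ℕ} {l l' A : ℝ} {f : (Fin (d + 1) → ℝ) → ℝ}
    (hf : DerivBound d r l A f) (hl' : 0 ≤ l') (hl : l' ≤ l) : DerivBound d r l' A f := by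
  intro w hw hr y
  refine le_trans ?_ (hf w hw hr y)
  gcongr

lemma DerivBound.mul {d r : ℕ} {l A B : ℝ} {f g : (Fin (d + 1) → ℝ) → ℝ} (hl : 0 < l)
    (hf : DerivBound d r l A f) (hg : DerivBound d r l B g)
    (hfc : ContDiff ℝ (r : ℕ∞) f) (hgc : ContDiff ℝ (r : ℕ∞) g) :
    DerivBound d r l (2 ^ r * (A * B)) (f * g) := by
  intro w hw hr y
  have hlen : w.length ≤ r := (length_le_wordWeight d w).trans hr.le
  have hA := fun u (hu : u.Sublist w) => hf u (hw.sublist hu)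
    ((wordWeight_le_of_sublist d hu).trans_lt hr)
  have hB := fun u (hu : u.Sublist w) => hg u (hw.sublist hu)
    ((wordWeight_le_of_sublist d hu).trans_lt hr)
  have hA0 : 0 ≤ A := le_trans (by positivity) (hA w (List.Sublist.refl _) y)
  have hB0 : 0 ≤ B := le_trans (by positivity) (hB w (List.Sublist.refl _) y)
  refine (abs_wordDeriv_mul_le w hl (hfc.of_le (by exact_mod_cast hlen))
    (hgc.of_le (by exact_mod_cast hlen)) hA hB y).trans ?_
  gcongr
  norm_num

lemma DerivBound.const_mul {d r : ℕ} {l A : ℝ} {f : (Fin (d + 1) → ℝ) → ℝ} (c : ℝ)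
    (hf : DerivBound d r l A f) (hfc : ContDiff ℝ (r : ℕ∞) f) :
    DerivBound d r l (|c| * A) (fun y => c * f y) := by
  intro w hw hr y
  have hlen : w.length ≤ r := (length_le_wordWeight d w).trans hr.le
  rw [wordDeriv_const_mul w c (hfc.of_le (by exact_mod_cast hlen)), abs_mul, mul_assoc]
  gcongr
  exact hf w hw hr y

lemma DerivBound.comp_affine {d r : ℕ} {l m A : ℝ} {f : (Fin (d + 1) → ℝ) → ℝ}
    (hf : DerivBound d r l A f) (hl : 0 < l) (hm : 0 < m) (hfc : ContDiff ℝ (r : ℕ∞) f)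
    (z : Fin (d + 1) → ℝ) :
    DerivBound d r (m * l) A (fun y => f (z + sclE d m⁻¹ y)) := by
  intro w hw hr y
  have hlen : w.length ≤ r := (length_le_wordWeight d w).trans hr.le
  rw [wordDeriv_comp_affine w _ z (hfc.of_le (by exact_mod_cast hlen))]
  refine le_trans (le_of_eq ?_) (hf w hw hr (z + sclE d m⁻¹ y))
  rw [abs_mul, abs_of_pos (by positivity), mul_pow, inv_pow]
  field_simp

lemma continuous_wordDeriv {d r : ℕ} {f : (Fin (d + 1) → ℝ) → ℝ} (hf : ContDiff ℝ (r : ℕ∞) f)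
    {w : List (Fin (d + 1))} (hw : wordWeight d w < r) : Continuous (wordDeriv d w f) := by
  refine (contDiff_wordDeriv (n := 0) w (hf.of_le ?_)).continuous
  have := length_le_wordWeight d w
  norm_cast
  omega

lemma finite_wordWeight_lt (d r : ℕ) : {w : List (Fin (d + 1)) | wordWeight d w < r}.Finite :=
  (List.finite_length_lt (Fin (d + 1)) r).subset
    fun w hw => (length_le_wordWeight d w).trans_lt hw

lemma exists_derivBound_of_forall {d r : ℕ} {f : (Fin (d + 1) → ℝ) → ℝ}
    (h : ∀ w, wordWeight d w < r → ∃ C, ∀ y, |wordDeriv d w f y| ≤ C) :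
    ∃ A, 0 < A ∧ DerivBound d r 1 A f := by
  choose! C hC using h
  obtain ⟨A, hA⟩ := ((finite_wordWeight_lt d r).image C).bddAbove
  refine ⟨max A 1, by positivity, fun w _ hr y => ?_⟩
  rw [one_pow, mul_one]
  exact (hC w hr y).trans ((hA (Set.mem_image_of_mem C hr)).trans (le_max_left _ _))

lemma exists_derivBound {d r : ℕ} {f : (Fin (d + 1) → ℝ) → ℝ} (hf : ContDiff ℝ (r : ℕ∞) f)
    (hc : HasCompactSupport f) : ∃ A, 0 < A ∧ DerivBound d r 1 A f :=
  exists_derivBound_of_forall fun w hw =>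
    (hasCompactSupport_wordDeriv w hc).exists_bound_of_continuous (continuous_wordDeriv hf hw)

lemma isClosed_box {d : ℕ} (z c : Fin (d + 1) → ℝ) :
    IsClosed {y : Fin (d + 1) → ℝ | ∀ i, |y i - z i| ≤ c i} := by
  simp only [Set.ofPred_forall]
  exact isClosed_iInter fun i => isClosed_le (by fun_prop) continuous_const

lemma isCompact_box {d : ℕ} (z c : Fin (d + 1) → ℝ) :
    IsCompact {y : Fin (d + 1) → ℝ | ∀ i, |y i - z i| ≤ c i} := by
  convert isCompact_univ_pi (fun i => isCompact_Icc (a := z i - c i) (b := z i + c i)) using 1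
  ext y
  simp only [Set.mem_ofPred_eq, Set.mem_univ_pi, Set.mem_Icc, abs_le]
  exact forall_congr' fun i => ⟨fun h => ⟨by linarith [h.1], by linarith [h.2]⟩,
    fun h => ⟨by linarith [h.1], by linarith [h.2]⟩⟩

lemma hasCompactSupport_of_box {d : ℕ} {f : (Fin (d + 1) → ℝ) → ℝ} {z c : Fin (d + 1) → ℝ}
    (h : ∀ y ∈ tsupport f, ∀ i, |y i - z i| ≤ c i) : HasCompactSupport f :=
  (isCompact_box z c).of_isClosed_subset (isClosed_tsupport f) h

lemma tsupport_subset_of_ne_zero {d : ℕ} {f : (Fin (d + 1) → ℝ) → ℝ} {s : Set (Fin (d + 1) → ℝ)}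
    (hs : IsClosed s) (h : ∀ y, f y ≠ 0 → y ∈ s) : tsupport f ⊆ s :=
  closure_minimal h hs

lemma sclE_sclE {d : ℕ} (a b : ℝ) (y : Fin (d + 1) → ℝ) :
    sclE d a (sclE d b y) = sclE d (a * b) y := by
  ext i; simp only [sclE, mul_pow]; ring

lemma sclE_one {d : ℕ} (y : Fin (d + 1) → ℝ) : sclE d 1 y = y := by
  ext i; simp [sclE]

lemma sclE_sub {d : ℕ} (a : ℝ) (y z : Fin (d + 1) → ℝ) :
    sclE d a (y - z) = sclE d a y - sclE d a z := by
  ext i; simp only [sclE, Pi.sub_apply]; ring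

lemma testScale_eq {d : ℕ} (l : ℝ) (z : Fin (d + 1) → ℝ) (φ : (Fin (d + 1) → ℝ) → ℝ) :
    testScale d l z φ = fun y => (l ^ (d + 2))⁻¹ * φ (-sclE d l⁻¹ z + sclE d l⁻¹ y) := by
  ext y
  rw [testScale, sclE_sub, neg_add_eq_sub]

lemma contDiff_testScale {d r : ℕ} {l : ℝ} {z : Fin (d + 1) → ℝ} {φ : (Fin (d + 1) → ℝ) → ℝ}
    (hφ : φ ∈ BrSet d r) : ContDiff ℝ (r : ℕ∞) (testScale d l z φ) := by
  rw [testScale_eq]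
  exact contDiff_const.mul (hφ.2.1.comp (contDiff_affine _ _))

lemma derivBound_testScale {d r : ℕ} {l : ℝ} (hl : 0 < l) {z : Fin (d + 1) → ℝ}
    {φ : (Fin (d + 1) → ℝ) → ℝ} (hφ : φ ∈ BrSet d r) :
    DerivBound d r l ((l ^ (d + 2))⁻¹) (testScale d l z φ) := by
  rw [testScale_eq]
  have h1 := (mem_BrSet_iff.1 hφ).2.2.comp_affine one_pos hl hφ.2.1 (-sclE d l⁻¹ z)
  have h2 := h1.const_mul ((l ^ (d + 2))⁻¹) (hφ.2.1.comp (contDiff_affine _ _))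
  rwa [mul_one, mul_one, abs_of_pos (by positivity)] at h2

lemma tsupport_testScale {d r : ℕ} {l : ℝ} (hl : 0 < l) {z : Fin (d + 1) → ℝ}
    {φ : (Fin (d + 1) → ℝ) → ℝ} (hφ : φ ∈ BrSet d r) :
    ∀ y ∈ tsupport (testScale d l z φ), ∀ i, |y i - z i| ≤ l ^ sE d i := by
  refine tsupport_subset_of_ne_zero (isClosed_box z fun i => l ^ sE d i) fun y hy i => ?_
  have h1 : φ (sclE d l⁻¹ (y - z)) ≠ 0 := right_ne_zero_of_mul hy
  have h2 := (mem_BrSet_iff.1 hφ).1 _ (subset_tsupport _ h1) i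
  simp only [sclE, Pi.sub_apply, abs_mul, inv_pow, abs_inv, abs_of_pos (pow_pos hl _)] at h2
  rwa [inv_mul_le_iff₀ (pow_pos hl _), mul_one] at h2

lemma isTest_testScale {d r : ℕ} {l : ℝ} (hl : 0 < l) {z : Fin (d + 1) → ℝ}
    {φ : (Fin (d + 1) → ℝ) → ℝ} (hφ : φ ∈ BrSet d r) {S : Set (Fin (d + 1) → ℝ)}
    (hS : ∀ y : Fin (d + 1) → ℝ, (∀ i, |y i - z i| ≤ l ^ sE d i) → y ∈ S) :
    IsTest d r S (testScale d l z φ) :=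
  ⟨contDiff_testScale hφ, hasCompactSupport_of_box (tsupport_testScale hl hφ),
    fun y hy => hS y (tsupport_testScale hl hφ y hy)⟩

lemma exists_eq_smul_testScale {d r : ℕ} {l A : ℝ} (hl : 0 < l) (hA : 0 < A)
    {z : Fin (d + 1) → ℝ} {f : (Fin (d + 1) → ℝ) → ℝ} (hf : ContDiff ℝ (r : ℕ∞) f)
    (hb : DerivBound d r l A f) (hs : ∀ y ∈ tsupport f, ∀ i, |y i - z i| ≤ l ^ sE d i) :
    ∃ φ ∈ BrSet d r, f = (A * l ^ (d + 2)) • testScale d l z φ := by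
  have hc : ContDiff ℝ (r : ℕ∞) fun y => f (z + sclE d l y) := hf.comp (contDiff_affine l z)
  refine ⟨fun y => A⁻¹ * f (z + sclE d l y), mem_BrSet_iff.2 ⟨?_, contDiff_const.mul hc, ?_⟩, ?_⟩
  · refine fun y hy i => ?_
    have := tsupport_subset_of_ne_zero (isClosed_box (0 : Fin (d + 1) → ℝ) fun _ => 1)
      (fun y hy i => ?_) hy
    · simpa using this i
    · have h1 := hs _ (subset_tsupport _ (right_ne_zero_of_mul hy)) i
      simp only [sclE, Pi.add_apply, add_sub_cancel_left, abs_mul,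
        abs_of_pos (pow_pos hl _)] at h1
      simpa using (mul_le_iff_le_one_right (pow_pos hl _)).1 h1
  · have h1 := hb.comp_affine hl (inv_pos.2 hl) hf z
    rw [inv_inv, inv_mul_cancel₀ hl.ne'] at h1
    have h2 := h1.const_mul A⁻¹ hc
    rwa [abs_of_pos (inv_pos.2 hA), inv_mul_cancel₀ hA.ne'] at h2
  · ext y
    have : z + sclE d l (sclE d l⁻¹ (y - z)) = y := by
      rw [sclE_sclE, mul_inv_cancel₀ hl.ne', sclE_one]; abel
    simp only [Pi.smul_apply, smul_eq_mul, testScale, this]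
    field_simp

lemma wordDeriv_comp_time {d : ℕ} (w : List (Fin (d + 1))) {b : ℝ → ℝ}
    (hb : ContDiff ℝ (⊤ : ℕ∞) b) (hc : HasCompactSupport b) :
    ∃ C, ∀ y : Fin (d + 1) → ℝ, |wordDeriv d w (fun y => b (y 0)) y| ≤ C := by
  induction w using List.reverseRecOn generalizing b with
  | nil =>
    obtain ⟨C, hC⟩ := hc.exists_bound_of_continuous hb.continuous
    exact ⟨C, fun y => hC (y 0)⟩
  | append_singleton w i ih =>
    have hD : ∀ y : Fin (d + 1) → ℝ, pdE d i (fun y => b (y 0)) y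
        = (Pi.single i (1 : ℝ) : Fin (d + 1) → ℝ) 0 * deriv b (y 0) := by
      intro y
      have h0 : HasFDerivAt (fun y : Fin (d + 1) → ℝ => y 0)
        (ContinuousLinearMap.proj (R := ℝ) (φ := fun _ : Fin (d + 1) => ℝ) 0) y :=
        (ContinuousLinearMap.proj (R := ℝ) (φ := fun _ : Fin (d + 1) => ℝ) 0).hasFDerivAt
      have h1 : HasFDerivAt b (fderiv ℝ b (y 0)) (y 0) :=
        ((hb.differentiable (by simp)) (y 0)).hasFDerivAt
      have h2 := (h1.comp y h0).fderiv
      simp only [pdE]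
      rw [show (fun y : Fin (d + 1) → ℝ => b (y 0)) = b ∘ (fun y => y 0) from rfl, h2]
      simp
    by_cases hi : i = 0
    · have : pdE d i (fun y => b (y 0)) = fun y => deriv b (y 0) := by
        ext y; rw [hD, hi]; simp
      obtain ⟨C, hC⟩ := ih (b := deriv b) ((contDiff_infty_iff_deriv.1 hb).2) hc.deriv
      refine ⟨C, fun y => ?_⟩
      rw [wordDeriv_append, wordDeriv_singleton, this]
      exact hC y
    · have : pdE d i (fun y => b (y 0)) = fun _ => 0 := by
        ext y; rw [hD, Pi.single_eq_of_ne (Ne.symm hi), zero_mul]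
      refine ⟨0, fun y => ?_⟩
      rw [wordDeriv_append, wordDeriv_singleton, this, wordDeriv_zero]
      simp

/-- The smooth function of time `S (a t - b) - S (t - c)` built from the smooth transition. -/
def timeBump (a b c t : ℝ) : ℝ := Real.smoothTransition (a * t - b) - Real.smoothTransition (t - c)

lemma contDiff_smoothTransition_comp {n : ℕ∞} (a b : ℝ) :
    ContDiff ℝ n fun t => Real.smoothTransition (a * t - b) :=
  Real.smoothTransition.contDiff.comp ((contDiff_const.mul contDiff_id).sub contDiff_const)

lemma contDiff_timeBump {n : ℕ∞} (a b c : ℝ) : ContDiff ℝ n (timeBump a b c) := by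
  have := contDiff_smoothTransition_comp (n := n) 1 c
  simp only [one_mul] at this
  exact (contDiff_smoothTransition_comp a b).sub this

lemma timeBump_eq_zero {a b c t : ℝ} (h : a * t ≤ b ∧ t ≤ c ∨ b + 1 ≤ a * t ∧ c + 1 ≤ t) :
    timeBump a b c t = 0 := by
  unfold timeBump
  rcases h with ⟨h1, h2⟩ | ⟨h1, h2⟩
  · rw [Real.smoothTransition.zero_of_nonpos (by linarith),
      Real.smoothTransition.zero_of_nonpos (by linarith), sub_zero]
  · rw [Real.smoothTransition.one_of_one_le (by linarith),
      Real.smoothTransition.one_of_one_le (by linarith), sub_self]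

lemma hasCompactSupport_timeBump {a : ℝ} (ha : 0 < a) (b c : ℝ) :
    HasCompactSupport (timeBump a b c) := by
  refine HasCompactSupport.intro (K := Set.Icc (min (b / a) c) (max ((b + 1) / a) (c + 1)))
    isCompact_Icc fun t ht => timeBump_eq_zero ?_
  rw [Set.mem_Icc, not_and_or, not_le, not_le, lt_min_iff, max_lt_iff, lt_div_iff₀ ha,
    div_lt_iff₀ ha] at ht
  rcases ht with h | h
  · exact Or.inl ⟨by linarith [h.1], h.2.le⟩
  · exact Or.inr ⟨by linarith [h.1], h.2.le⟩

lemma exists_derivBound_timeBump (d r : ℕ) {a : ℝ} (ha : 0 < a) (b c : ℝ) :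
    ∃ C, 0 < C ∧ ∀ l : ℝ, 0 < l →
      DerivBound d r l C (fun y => timeBump a b c (y 0 / l ^ 2)) := by
  obtain ⟨C, hC, hb⟩ := exists_derivBound_of_forall (d := d) (r := r)
    (f := fun y => timeBump a b c (y 0)) fun w _ =>
      wordDeriv_comp_time w (contDiff_timeBump a b c) (hasCompactSupport_timeBump ha b c)
  refine ⟨C, hC, fun l hl => ?_⟩
  have h := hb.comp_affine one_pos hl
    ((contDiff_timeBump a b c).comp (contDiff_apply ℝ ℝ (0 : Fin (d + 1)))) 0
  rw [mul_one] at h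
  convert h using 3 with y
  simp [sclE, sE_zero]
  ring

/-- Product bump whose half-integer translates form a partition of unity. -/
def cellBump (d : ℕ) (y : Fin (d + 1) → ℝ) : ℝ := ∏ i, timeBump 1 (-1) 0 (2 * y i)

/-- The cutoff attached to the cell with index `m` of the parabolic grid of size `l`. -/
def gridBump (d : ℕ) (l : ℝ) (m : Fin (d + 1) → ℝ) (y : Fin (d + 1) → ℝ) : ℝ :=
  ∏ i, timeBump 1 (-1) 0 (2 * y i / l ^ sE d i - m i)

lemma gridBump_eq (d : ℕ) (l : ℝ) (m : Fin (d + 1) → ℝ) :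
    gridBump d l m = fun y => cellBump d ((fun i => -(m i / 2)) + sclE d l⁻¹ y) := by
  ext y
  refine Finset.prod_congr rfl fun i _ => ?_
  congr 1
  simp only [sclE, Pi.add_apply, inv_pow]
  ring

lemma contDiff_cellBump (d : ℕ) {n : ℕ∞} : ContDiff ℝ n (cellBump d) :=
  contDiff_prod fun i _ =>
    (contDiff_timeBump _ _ _).comp (contDiff_const.mul (contDiff_apply ℝ ℝ i))

lemma contDiff_gridBump (d : ℕ) (l : ℝ) (m) {n : ℕ∞} : ContDiff ℝ n (gridBump d l m) := by
  rw [gridBump_eq]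
  exact (contDiff_cellBump d).comp (contDiff_affine _ _)

lemma abs_le_one_of_timeBump_ne_zero {t : ℝ} (h : timeBump 1 (-1) 0 t ≠ 0) : |t| ≤ 1 := by
  by_contra! hc
  refine h (timeBump_eq_zero ?_)
  rcases lt_abs.1 hc with h | h
  · exact Or.inr ⟨by linarith, by linarith⟩
  · exact Or.inl ⟨by linarith, by linarith⟩

lemma hasCompactSupport_cellBump (d : ℕ) : HasCompactSupport (cellBump d) := by
  refine HasCompactSupport.intro (isCompact_box (0 : Fin (d + 1) → ℝ) fun _ => 1) fun y hy => ?_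
  by_contra h
  refine hy fun i => ?_
  have := abs_le_one_of_timeBump_ne_zero (Finset.prod_ne_zero_iff.1 h i (Finset.mem_univ i))
  rw [abs_mul, abs_two] at this
  simp only [Pi.zero_apply, sub_zero]
  linarith [abs_nonneg (y i)]

lemma exists_derivBound_gridBump (d r : ℕ) :
    ∃ C, 0 < C ∧ ∀ l : ℝ, 0 < l → ∀ m, DerivBound d r l C (gridBump d l m) := by
  obtain ⟨C, hC, hb⟩ := exists_derivBound (r := r) (contDiff_cellBump d)
    (hasCompactSupport_cellBump d)
  refine ⟨C, hC, fun l hl m => ?_⟩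
  have h := hb.comp_affine one_pos hl (contDiff_cellBump d) (fun i => -(m i / 2))
  rwa [mul_one, ← gridBump_eq] at h

lemma abs_le_of_mem_tsupport_gridBump {d : ℕ} {l : ℝ} {m y : Fin (d + 1) → ℝ}
    (hy : y ∈ tsupport (gridBump d l m)) (i : Fin (d + 1)) :
    |2 * y i / l ^ sE d i - m i| ≤ 1 := by
  have hcl : IsClosed {y : Fin (d + 1) → ℝ | ∀ i, |2 * y i / l ^ sE d i - m i| ≤ 1} := by
    simp only [Set.ofPred_forall]
    exact isClosed_iInter fun i => isClosed_le (by fun_prop) continuous_const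
  exact tsupport_subset_of_ne_zero hcl (fun y hy i => abs_le_one_of_timeBump_ne_zero
    (Finset.prod_ne_zero_iff.1 hy i (Finset.mem_univ i))) hy i

lemma sum_gridBump_eq_one {d N : ℕ} {l : ℝ} {y : Fin (d + 1) → ℝ}
    (hy : ∀ i, |2 * y i / l ^ sE d i| + 1 ≤ N) :
    ∑ m ∈ Fintype.piFinset fun _ : Fin (d + 1) => Finset.range (2 * N),
      gridBump d l (fun i => (m i : ℝ) - N) y = 1 := by
  unfold gridBump
  rw [← Finset.prod_univ_sum (fun _ : Fin (d + 1) => Finset.range (2 * N))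
    (fun i (j : ℕ) => timeBump 1 (-1) 0 (2 * y i / l ^ sE d i - ((j : ℝ) - N)))]
  refine Finset.prod_eq_one fun i _ => ?_
  have h := abs_le.1 (le_sub_iff_add_le.2 (hy i))
  generalize 2 * y i / l ^ sE d i = x at h
  have : ∀ j : ℕ, timeBump 1 (-1) 0 (x - ((j : ℝ) - N))
      = Real.smoothTransition (x - j + N + 1) - Real.smoothTransition (x - (j + 1 : ℕ) + N + 1) := by
    intro j
    unfold timeBump
    congr 2 <;> push_cast <;> ring
  simp only [this]
  rw [Finset.sum_range_sub' (fun j : ℕ => Real.smoothTransition (x - j + N + 1)),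
    Real.smoothTransition.one_of_one_le (by push_cast; linarith [h.1]),
    Real.smoothTransition.zero_of_nonpos (by push_cast; linarith [h.2]), sub_zero]

/-- The local size `sup_(φ ∈ 𝓑^r) |η(φ^l_z)|` of a functional at scale `l` around `z`. -/
def supBr (d r : ℕ) (η : ((Fin (d + 1) → ℝ) → ℝ) → ℝ) (l : ℝ) (z : Fin (d + 1) → ℝ) : ENNReal :=
  ⨆ φ ∈ BrSet d r, ENNReal.ofReal |η (testScale d l z φ)|

section Functional

variable {d r : ℕ} {S : Set (Fin (d + 1) → ℝ)} {η : ((Fin (d + 1) → ℝ) → ℝ) → ℝ}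

lemma IsTest.mono {S' : Set (Fin (d + 1) → ℝ)} {f : (Fin (d + 1) → ℝ) → ℝ} (hf : IsTest d r S f)
    (h : tsupport f ⊆ S') : IsTest d r S' f := ⟨hf.1, hf.2.1, h⟩

lemma IsTest.mul_right {f g : (Fin (d + 1) → ℝ) → ℝ} (hf : IsTest d r S f)
    (hg : ContDiff ℝ (r : ℕ∞) g) : IsTest d r S (f * g) :=
  ⟨hf.1.mul hg, hf.2.1.mul_right, (tsupport_mul_subset_left).trans hf.2.2⟩

lemma IsTest.add {f g : (Fin (d + 1) → ℝ) → ℝ} (hf : IsTest d r S f) (hg : IsTest d r S g) :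
    IsTest d r S (f + g) :=
  ⟨hf.1.add hg.1, hf.2.1.add hg.2.1, (tsupport_add f g).trans (Set.union_subset hf.2.2 hg.2.2)⟩

lemma IsTest.smul {f : (Fin (d + 1) → ℝ) → ℝ} (c : ℝ) (hf : IsTest d r S f) :
    IsTest d r S (c • f) :=
  ⟨contDiff_const.smul hf.1, hf.2.1.smul_left (f := fun _ => c),
    (tsupport_smul_subset_right (fun _ => c) f).trans hf.2.2⟩

lemma isTest_zero : IsTest d r S (0 : (Fin (d + 1) → ℝ) → ℝ) :=
  ⟨contDiff_const, HasCompactSupport.zero, by simp [tsupport]⟩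

lemma LinOn.map_zero (hη : LinOn d r S η) : η 0 = 0 := by
  have := hη.2 0 0 isTest_zero
  simpa using this

lemma LinOn.map_sum (hη : LinOn d r S η) {ι : Type*} (s : Finset ι)
    (f : ι → (Fin (d + 1) → ℝ) → ℝ) (hf : ∀ i ∈ s, IsTest d r S (f i)) :
    IsTest d r S (∑ i ∈ s, f i) ∧ η (∑ i ∈ s, f i) = ∑ i ∈ s, η (f i) := by
  classical
  induction s using Finset.induction_on with
  | empty => simpa using ⟨isTest_zero, hη.map_zero⟩
  | insert a s ha ih =>
    have ⟨h1, h2⟩ := ih fun i hi => hf i (Finset.mem_insert_of_mem hi)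
    have h3 := hf a (Finset.mem_insert_self a s)
    rw [Finset.sum_insert ha, Finset.sum_insert ha, hη.1 _ _ h3 h1, h2]
    exact ⟨h3.add h1, rfl⟩

lemma LinOn.map_sub (hη : LinOn d r S η) {f g : (Fin (d + 1) → ℝ) → ℝ} (hf : IsTest d r S f)
    (hg : IsTest d r S g) : IsTest d r S (f - g) ∧ η (f - g) = η f - η g := by
  have h : f - g = f + (-1 : ℝ) • g := by simp [sub_eq_add_neg]
  rw [h, hη.1 _ _ hf (hg.smul _), hη.2 _ _ hg]
  exact ⟨hf.add (hg.smul _), by ring⟩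

lemma ofReal_abs_le_supBr (hη : LinOn d r S η) {f : (Fin (d + 1) → ℝ) → ℝ} (hf : IsTest d r S f)
    {l A : ℝ} (hl : 0 < l) (hA : 0 < A) (hb : DerivBound d r l A f) {z : Fin (d + 1) → ℝ}
    (hs : ∀ y ∈ tsupport f, ∀ i, |y i - z i| ≤ l ^ sE d i) :
    ENNReal.ofReal |η f| ≤ ENNReal.ofReal (A * l ^ (d + 2)) * supBr d r η l z := by
  obtain ⟨φ, hφ, rfl⟩ := exists_eq_smul_testScale hl hA hf.1 hb hs
  have hc : 0 < A * l ^ (d + 2) := by positivity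
  have ht : IsTest d r S (testScale d l z φ) := by
    have := hf.smul (A * l ^ (d + 2))⁻¹
    rwa [smul_smul, inv_mul_cancel₀ hc.ne', one_smul] at this
  rw [hη.2 _ _ ht, abs_mul, abs_of_pos hc, ENNReal.ofReal_mul hc.le]
  gcongr
  exact le_iSup₂ (f := fun φ (_ : φ ∈ BrSet d r) => ENNReal.ofReal |η (testScale d l z φ)|) φ hφ

lemma exists_forall_box {f : (Fin (d + 1) → ℝ) → ℝ} (hf : HasCompactSupport f) (l : ℝ) :
    ∃ N : ℕ, ∀ y ∈ tsupport f, ∀ i, |2 * y i / l ^ sE d i| + 1 ≤ N := by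
  have : ∀ i, ∃ C, ∀ y ∈ tsupport f, |2 * y i / l ^ sE d i| ≤ C := fun i => by
    have hc : Continuous fun y : Fin (d + 1) → ℝ => 2 * y i / l ^ sE d i := by fun_prop
    exact IsCompact.exists_bound_of_continuousOn hf hc.continuousOn
  choose C hC using this
  obtain ⟨D, hD⟩ := (Set.finite_range C).bddAbove
  obtain ⟨N, hN⟩ := exists_nat_ge (D + 1)
  refine ⟨N, fun y hy i => ?_⟩
  linarith [hC i y hy, hD (Set.mem_range_self i)]

lemma eq_sum_mul_gridBump {f : (Fin (d + 1) → ℝ) → ℝ} {N : ℕ} {l : ℝ}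
    (hN : ∀ y ∈ tsupport f, ∀ i, |2 * y i / l ^ sE d i| + 1 ≤ N) :
    f = ∑ m ∈ Fintype.piFinset fun _ : Fin (d + 1) => Finset.range (2 * N),
      f * gridBump d l (fun i => (m i : ℝ) - N) := by
  ext y
  rw [Finset.sum_apply]
  simp only [Pi.mul_apply]
  rw [← Finset.mul_sum]
  by_cases hy : y ∈ tsupport f
  · rw [sum_gridBump_eq_one (hN y hy), mul_one]
  · rw [image_eq_zero_of_notMem_tsupport hy, zero_mul]

/-- The cell with index `m` of the parabolic grid of size `l`. -/
def gridCell (d : ℕ) (l : ℝ) (m : Fin (d + 1) → ℝ) : Set (Fin (d + 1) → ℝ) :=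
  Set.univ.pi fun i => Set.Ico (m i * l ^ sE d i / 2) ((m i + 1) * l ^ sE d i / 2)

lemma volume_gridCell {l : ℝ} (hl : 0 < l) (m : Fin (d + 1) → ℝ) :
    volume (gridCell d l m) = ENNReal.ofReal (l ^ (d + 2) / 2 ^ (d + 1)) := by
  rw [gridCell, Real.volume_pi_Ico, ← ENNReal.ofReal_prod_of_nonneg (fun i _ => ?_)]
  · congr 1
    calc _ = ∏ i : Fin (d + 1), l ^ sE d i / 2 := Finset.prod_congr rfl fun i _ => by ring
      _ = _ := by
        rw [Finset.prod_div_distrib, Finset.prod_pow_eq_pow_sum, sum_sE]; simp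
  · have := pow_pos hl (sE d i)
    linarith

lemma abs_le_of_mem_gridCell {l : ℝ} (hl : 0 < l) {m z : Fin (d + 1) → ℝ}
    (hz : z ∈ gridCell d l m) (i : Fin (d + 1)) :
    0 ≤ 2 * z i / l ^ sE d i - m i ∧ 2 * z i / l ^ sE d i - m i < 1 := by
  have h := hz i (Set.mem_univ i)
  have hp := pow_pos hl (sE d i)
  constructor
  · rw [sub_nonneg, le_div_iff₀ hp]
    linarith [h.1]
  · rw [sub_lt_iff_lt_add, div_lt_iff₀ hp]
    linarith [h.2]

lemma abs_sub_le_of_gridCell {l : ℝ} (hl : 0 < l) {m y z : Fin (d + 1) → ℝ}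
    (hz : z ∈ gridCell d l m) {i : Fin (d + 1)} (hy : |2 * y i / l ^ sE d i - m i| ≤ 1) :
    |y i - z i| ≤ l ^ sE d i := by
  have hp := pow_pos hl (sE d i)
  have h1 := abs_le_of_mem_gridCell hl hz i
  have h2 := abs_le.1 hy
  have h3 : y i - z i = (2 * y i / l ^ sE d i - 2 * z i / l ^ sE d i) * (l ^ sE d i / 2) := by
    field_simp
  rw [h3, abs_mul, abs_of_pos (half_pos hp)]
  have : |2 * y i / l ^ sE d i - 2 * z i / l ^ sE d i| ≤ 2 := by
    rw [abs_le]; constructor <;> linarith [h1.1, h1.2, h2.1, h2.2]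
  nlinarith

lemma disjoint_gridCell {l : ℝ} (hl : 0 < l) {N : ℕ} {m m' : Fin (d + 1) → ℕ} (h : m ≠ m') :
    Disjoint (gridCell d l fun i => (m i : ℝ) - N) (gridCell d l fun i => (m' i : ℝ) - N) := by
  rw [Set.disjoint_left]
  intro z hz hz'
  refine h (funext fun i => ?_)
  have h1 := abs_le_of_mem_gridCell hl hz i
  have h2 := abs_le_of_mem_gridCell hl hz' i
  have h3 : (m i : ℝ) < m' i + 1 := by linarith [h1.1, h1.2, h2.1, h2.2]
  have h4 : (m' i : ℝ) < m i + 1 := by linarith [h1.1, h1.2, h2.1, h2.2]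
  norm_cast at h3 h4
  omega

/-- Grid decomposition: a functional is controlled on a test function with derivative bounds at
scale `l` by the integral of its local size over a neighbourhood of the support. -/
lemma exists_grid_bound (d r : ℕ) : ∃ C : ℝ, 0 < C ∧
    ∀ (S : Set (Fin (d + 1) → ℝ)) (η : ((Fin (d + 1) → ℝ) → ℝ) → ℝ), LinOn d r S η →
    ∀ f, IsTest d r S f → ∀ l A : ℝ, 0 < l → 0 < A → DerivBound d r l A f →
    ∀ W : Set (Fin (d + 1) → ℝ),
      (∀ y ∈ tsupport f, ∀ z : Fin (d + 1) → ℝ, (∀ i, |y i - z i| ≤ l ^ sE d i) → z ∈ W) →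
      ENNReal.ofReal |η f| ≤ ENNReal.ofReal (C * A) * ∫⁻ z in W, supBr d r η l z := by
  classical
  obtain ⟨C, hC, hb⟩ := exists_derivBound_gridBump d r
  refine ⟨2 ^ r * C * 2 ^ (d + 1), by positivity, ?_⟩
  intro S η hη f hf l A hl hA hfb W hW
  obtain ⟨N, hN⟩ := exists_forall_box hf.2.1 l
  set F := Fintype.piFinset fun _ : Fin (d + 1) => Finset.range (2 * N)
  set P : (Fin (d + 1) → ℕ) → (Fin (d + 1) → ℝ) → ℝ :=
    fun m => f * gridBump d l (fun i => (m i : ℝ) - N)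
  set Q : (Fin (d + 1) → ℕ) → Set (Fin (d + 1) → ℝ) := fun m => gridCell d l fun i => (m i : ℝ) - N
  have hP : ∀ m, IsTest d r S (P m) := fun m => hf.mul_right (contDiff_gridBump d l _)
  have hsum : η f = ∑ m ∈ F, η (P m) := by
    rw [← (hη.map_sum F P fun m _ => hP m).2]
    exact congrArg η (eq_sum_mul_gridBump hN)
  have hPz : ∀ m, ¬ Q m ⊆ W → η (P m) = 0 := by
    intro m hm
    have : P m = 0 := by
      by_contra hne
      obtain ⟨y, hy⟩ := Function.ne_iff.1 hne
      have hy1 : y ∈ tsupport f := subset_tsupport _ (left_ne_zero_of_mul hy)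
      have hy2 : y ∈ tsupport (gridBump d l fun i => (m i : ℝ) - N) :=
        subset_tsupport _ (right_ne_zero_of_mul hy)
      exact hm fun z hz => hW y hy1 z fun i =>
        abs_sub_le_of_gridCell hl hz (abs_le_of_mem_tsupport_gridBump hy2 i)
    rw [this, hη.map_zero]
  have hPb : ∀ m, ENNReal.ofReal |η (P m)|
      ≤ ENNReal.ofReal (2 ^ r * C * 2 ^ (d + 1) * A) * ∫⁻ z in Q m, supBr d r η l z := by
    intro m
    have hpt : ∀ z ∈ Q m, ENNReal.ofReal |η (P m)|
        ≤ ENNReal.ofReal (2 ^ r * (A * C) * l ^ (d + 2)) * supBr d r η l z := by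
      intro z hz
      refine ofReal_abs_le_supBr hη (hP m) hl (by positivity)
        (hfb.mul hl (hb l hl _) hf.1 (contDiff_gridBump d l _)) fun y hy i => ?_
      exact abs_sub_le_of_gridCell hl hz
        (abs_le_of_mem_tsupport_gridBump (tsupport_mul_subset_right hy) i)
    have hint : ENNReal.ofReal |η (P m)| * ENNReal.ofReal (l ^ (d + 2) / 2 ^ (d + 1))
        ≤ ENNReal.ofReal (2 ^ r * (A * C) * l ^ (d + 2)) * ∫⁻ z in Q m, supBr d r η l z := by
      rw [← volume_gridCell hl (fun i => (m i : ℝ) - N), ← setLIntegral_const,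
        ← lintegral_const_mul' _ _ ENNReal.ofReal_ne_top]
      exact setLIntegral_mono' (MeasurableSet.univ_pi fun i => measurableSet_Ico) hpt
    have hv : (0 : ℝ) < l ^ (d + 2) / 2 ^ (d + 1) := by positivity
    rw [← ENNReal.le_div_iff_mul_le (Or.inl (by simpa using hv)) (Or.inl ENNReal.ofReal_ne_top),
      ENNReal.mul_div_right_comm, ← ENNReal.ofReal_div_of_pos hv] at hint
    refine hint.trans (le_of_eq ?_)
    congr 2
    field_simp
  calc ENNReal.ofReal |η f| ≤ ENNReal.ofReal (∑ m ∈ F, |η (P m)|) := by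
        rw [hsum]; exact ENNReal.ofReal_le_ofReal (Finset.abs_sum_le_sum_abs _ _)
    _ = ∑ m ∈ F, ENNReal.ofReal |η (P m)| :=
        ENNReal.ofReal_sum_of_nonneg fun m _ => abs_nonneg _
    _ = ∑ m ∈ F with Q m ⊆ W, ENNReal.ofReal |η (P m)| := by
        rw [Finset.sum_filter]
        refine Finset.sum_congr rfl fun m _ => ?_
        split_ifs with h
        · rfl
        · simp [hPz m h]
    _ ≤ ∑ m ∈ F with Q m ⊆ W, ENNReal.ofReal (2 ^ r * C * 2 ^ (d + 1) * A)
          * ∫⁻ z in Q m, supBr d r η l z := Finset.sum_le_sum fun m _ => hPb m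
    _ = ENNReal.ofReal (2 ^ r * C * 2 ^ (d + 1) * A)
          * ∫⁻ z in ⋃ m ∈ F.filter (Q · ⊆ W), Q m, supBr d r η l z := by
        rw [← Finset.mul_sum, lintegral_biUnion_finset]
        · exact fun m _ m' _ h => disjoint_gridCell hl h
        · exact fun m _ => MeasurableSet.univ_pi fun i => measurableSet_Ico
    _ ≤ _ := by
        gcongr
        exact Set.iUnion₂_subset fun m hm => (Finset.mem_filter.1 hm).2

end Functional

section LpE

variable {d : ℕ} {p : ENNReal} {μ : Measure (Fin (d + 1) → ℝ)}
  {f g : (Fin (d + 1) → ℝ) → ENNReal}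

lemma lpE_eq_eLpNorm (hp : 1 ≤ p) (g : (Fin (d + 1) → ℝ) → ENNReal) :
    lpE d μ p g = eLpNorm g p μ := by
  rw [lpE]
  split_ifs with h
  · subst h
    simp [eLpNorm_exponent_top, eLpNormEssSup]
  · rw [eLpNorm_eq_eLpNorm' (by positivity) h]
    simp [eLpNorm']

lemma lpE_top (g : (Fin (d + 1) → ℝ) → ENNReal) : lpE d μ ⊤ g = essSup g μ := by simp [lpE]

lemma lpE_of_ne_top (h : p ≠ ⊤) (g : (Fin (d + 1) → ℝ) → ENNReal) :
    lpE d μ p g = (∫⁻ z, g z ^ p.toReal ∂μ) ^ (1 / p.toReal) := by simp [lpE, h]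

lemma lpE_mono_ae (hfg : ∀ᵐ z ∂μ, f z ≤ g z) : lpE d μ p f ≤ lpE d μ p g := by
  simp only [lpE]
  split_ifs with h
  · exact essSup_mono_ae hfg
  · have : ∀ᵐ z ∂μ, f z ^ p.toReal ≤ g z ^ p.toReal := by
      filter_upwards [hfg] with z hz
      gcongr
    exact ENNReal.rpow_le_rpow (lintegral_mono_ae this) (by positivity)

lemma lpE_mono (hfg : ∀ z, f z ≤ g z) : lpE d μ p f ≤ lpE d μ p g :=
  lpE_mono_ae (ae_of_all _ hfg)

lemma lpE_mono_measure {μ' : Measure (Fin (d + 1) → ℝ)} (h : μ ≤ μ') :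
    lpE d μ p g ≤ lpE d μ' p g := by
  simp only [lpE]
  split_ifs
  · exact essSup_mono_measure (Measure.absolutelyContinuous_of_le h)
  · gcongr

lemma lpE_const_mul (hp : 1 ≤ p) {c : ENNReal} (hc : c ≠ ⊤) :
    lpE d μ p (fun z => c * g z) = c * lpE d μ p g := by
  simp only [lpE]
  split_ifs with h
  · exact ENNReal.essSup_const_mul
  · have h0 : 0 < p.toReal := ENNReal.toReal_pos (by positivity) h
    simp only [ENNReal.mul_rpow_of_nonneg _ _ h0.le]
    rw [lintegral_const_mul' _ _ (by simp [hc, h0.le]), ENNReal.mul_rpow_of_nonneg _ _ (by positivity),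
      ← ENNReal.rpow_mul, mul_one_div_cancel h0.ne', ENNReal.rpow_one]

lemma lpE_sum_le (hp : 1 ≤ p) {ι : Type*} (s : Finset ι) {a : ι → (Fin (d + 1) → ℝ) → ENNReal}
    (ha : ∀ i ∈ s, AEMeasurable (a i) μ) :
    lpE d μ p (fun z => ∑ i ∈ s, a i z) ≤ ∑ i ∈ s, lpE d μ p (a i) := by
  simp only [lpE_eq_eLpNorm hp]
  have : (fun z => ∑ i ∈ s, a i z) = ∑ i ∈ s, a i := by
    ext z
    simp
  rw [this]
  exact eLpNorm_sum_le (fun i hi => (ha i hi).aestronglyMeasurable) hp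

lemma lpE_tsum_le (hp : 1 ≤ p) {a : ℕ → (Fin (d + 1) → ℝ) → ENNReal}
    (ha : ∀ n, Measurable (a n)) :
    lpE d μ p (fun z => ∑' n, a n z) ≤ ∑' n, lpE d μ p (a n) := by
  have hfin : ∀ N, lpE d μ p (fun z => ∑ n ∈ Finset.range N, a n z) ≤ ∑' n, lpE d μ p (a n) :=
    fun N => (lpE_sum_le hp _ fun n _ => (ha n).aemeasurable).trans (ENNReal.sum_le_tsum _)
  by_cases h : p = ⊤
  · subst h
    rw [lpE_top]
    refine essSup_le_of_ae_le _ ?_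
    have : ∀ᵐ z ∂μ, ∀ N, ∑ n ∈ Finset.range N, a n z ≤ ∑' n, lpE d μ ⊤ (a n) := by
      rw [ae_all_iff]
      intro N
      have h1 := hfin N
      rw [lpE_top] at h1
      filter_upwards [ENNReal.ae_le_essSup (μ := μ) fun z => ∑ n ∈ Finset.range N, a n z] with z hz
      exact hz.trans h1
    filter_upwards [this] with z hz
    rw [ENNReal.tsum_eq_iSup_nat]
    exact iSup_le hz
  · have h0 : 0 < p.toReal := ENNReal.toReal_pos (by positivity) h
    simp only [lpE_of_ne_top h] at hfin ⊢
    have h1 : ∀ z, (∑' n, a n z) ^ p.toReal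
        = ⨆ N, (∑ n ∈ Finset.range N, a n z) ^ p.toReal := by
      intro z
      rw [ENNReal.tsum_eq_iSup_nat]
      exact (ENNReal.orderIsoRpow _ h0).map_iSup _
    simp only [h1]
    rw [lintegral_iSup]
    · rw [one_div, ENNReal.rpow_inv_le_iff h0]
      refine iSup_le fun N => ?_
      rw [← ENNReal.rpow_inv_le_iff h0, ← one_div]
      exact hfin N
    · intro N
      exact (Finset.measurable_sum _ fun n _ => ha n).pow_const _
    · intro N M hNM z
      dsimp only
      gcongr

/-- Hölder's inequality against the constant function, for arbitrary functions. -/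
lemma setLIntegral_le_lpE (hp : 1 ≤ p) (s : Set (Fin (d + 1) → ℝ)) :
    ∫⁻ z in s, g z ≤ lpE d (volume.restrict s) p g * volume s ^ (1 - p⁻¹.toReal) := by
  obtain ⟨h, hm, hle, heq⟩ := exists_measurable_le_forall_setLIntegral_eq volume g
  rw [heq s]
  refine le_trans ?_ (mul_le_mul_left (lpE_mono hle) _)
  have := eLpNorm_le_eLpNorm_mul_rpow_measure_univ (μ := volume.restrict s) hp
    hm.aestronglyMeasurable
  rw [eLpNorm_one_eq_lintegral_enorm] at this
  simpa [lpE_eq_eLpNorm hp] using this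

end LpE

section Slab

variable {d : ℕ} {p : ENNReal} {g : (Fin (d + 1) → ℝ) → ENNReal} {J : Set ℝ}

/-- The times in `J` and the cube `[-N, N)^d` in space. -/
def slab (d : ℕ) (J : Set ℝ) (N : ℕ) : Set (Fin (d + 1) → ℝ) :=
  {z | z 0 ∈ J ∧ ∀ i : Fin d, z i.succ ∈ Set.Ico (-N : ℝ) N}

/-- Invariance of a function under integer translations in space, at times in `J`. -/
def PeriodicAt (d : ℕ) (J : Set ℝ) (g : (Fin (d + 1) → ℝ) → ENNReal) : Prop :=
  ∀ z : Fin (d + 1) → ℝ, z 0 ∈ J → ∀ m : Fin d → ℤ, g (z + Fin.cons 0 fun i => (m i : ℝ)) = g z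

lemma PeriodicAt.mono {J' : Set ℝ} (hg : PeriodicAt d J g) (h : J' ⊆ J) : PeriodicAt d J' g :=
  fun z hz m => hg z (h hz) m

lemma strip_eq_pi (d : ℕ) (J : Set ℝ) :
    strip d J = Set.univ.pi (Fin.cons J fun _ : Fin d => Set.Ico (0 : ℝ) 1) := by
  ext z
  simp [strip, Set.mem_pi, Fin.forall_fin_succ]

lemma slab_eq_pi (d : ℕ) (J : Set ℝ) (N : ℕ) :
    slab d J N = Set.univ.pi (Fin.cons J fun _ : Fin d => Set.Ico (-N : ℝ) N) := by
  ext z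
  simp [slab, Set.mem_pi, Fin.forall_fin_succ]

lemma measurableSet_strip (hJ : MeasurableSet J) : MeasurableSet (strip d J) := by
  rw [strip_eq_pi]
  refine MeasurableSet.univ_pi fun i => ?_
  refine Fin.cases ?_ (fun i => ?_) i
  · simpa using hJ
  · simp

lemma volume_slab (J : Set ℝ) (N : ℕ) : volume (slab d J N) = volume J * (2 * N) ^ d := by
  rw [slab_eq_pi, volume_pi_pi]
  simp [Fin.prod_univ_succ, ← two_mul, ENNReal.ofReal_mul]

/-- The integer translation with index `m`. -/
def latticeShift (d N : ℕ) (m : Fin d → ℕ) : Fin (d + 1) → ℝ :=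
  Fin.cons 0 fun i => ((m i : ℤ) - (N : ℤ) : ℤ)

lemma slab_subset_iUnion (N : ℕ) :
    slab d J N ⊆ ⋃ m ∈ Fintype.piFinset fun _ : Fin d => Finset.range (2 * N),
      (fun z => z + latticeShift d N m) '' strip d J := by
  intro z hz
  have hfl : ∀ i : Fin d, 0 ≤ ⌊z i.succ⌋ + N ∧ ⌊z i.succ⌋ + N < 2 * N := fun i => by
    have h1 : (-N : ℤ) ≤ ⌊z i.succ⌋ := Int.le_floor.2 (by simpa using (hz.2 i).1)
    have h2 : ⌊z i.succ⌋ < (N : ℤ) := Int.floor_lt.2 (by simpa using (hz.2 i).2)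
    constructor <;> linarith
  have hcast : ∀ i : Fin d, (((⌊z i.succ⌋ + N).toNat : ℤ) - (N : ℤ) : ℤ) = ⌊z i.succ⌋ := fun i => by
    rw [Int.toNat_of_nonneg (hfl i).1]; ring
  simp only [Set.mem_iUnion, Fintype.mem_piFinset, Finset.mem_range]
  refine ⟨fun i => (⌊z i.succ⌋ + N).toNat, fun i => ?_,
    z - latticeShift d N fun i => (⌊z i.succ⌋ + N).toNat, ⟨?_, fun i => ?_⟩, by simp⟩
  · have := hfl i
    dsimp only
    omega
  · simpa [latticeShift] using hz.1
  · simp only [latticeShift, Pi.sub_apply, Fin.cons_succ, hcast]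
    exact ⟨by linarith [Int.floor_le (z i.succ)], by linarith [Int.lt_floor_add_one (z i.succ)]⟩

lemma volume_restrict_slab_le (N : ℕ) :
    volume.restrict (slab d J N)
      ≤ Measure.sum fun m : Fintype.piFinset fun _ : Fin d => Finset.range (2 * N) =>
        (volume.restrict (strip d J)).map (fun z => z + latticeShift d N m) := by
  have h1 : ∀ m : Fin d → ℕ, (volume.restrict (strip d J)).map (fun z => z + latticeShift d N m)
      = volume.restrict ((fun z => z + latticeShift d N m) '' strip d J) := fun m => by
    have he := measurableEmbedding_addRight (latticeShift d N m)
    have := he.restrict_map volume ((fun z => z + latticeShift d N m) '' strip d J)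
    rw [Set.preimage_image_eq _ he.injective] at this
    rw [← this, (measurePreserving_add_right volume (latticeShift d N m)).map_eq]
  simp only [h1]
  refine (Measure.restrict_mono (slab_subset_iUnion N) le_rfl).trans ?_
  have : (⋃ m ∈ Fintype.piFinset fun _ : Fin d => Finset.range (2 * N),
      (fun z => z + latticeShift d N m) '' strip d J)
      = ⋃ m : Fintype.piFinset fun _ : Fin d => Finset.range (2 * N),
      (fun z => z + latticeShift d N m) '' strip d J := by
    rw [Set.iUnion_subtype]
  rw [this]
  exact Measure.restrict_iUnion_le

lemma lpE_slab_le (hp : 1 ≤ p) (hJ : MeasurableSet J) (hg : PeriodicAt d J g) {N : ℕ} (hN : 1 ≤ N) :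
    lpE d (volume.restrict (slab d J N)) p g
      ≤ (2 * N) ^ d * lpE d (volume.restrict (strip d J)) p g := by
  have hgm : ∀ z ∈ strip d J, ∀ m, g (z + latticeShift d N m) = g z := fun z hz m => hg z hz.1 _
  have hN1 : (1 : ENNReal) ≤ (2 * N) ^ d := by
    refine one_le_pow₀ ?_
    have : (1 : ENNReal) ≤ N := by exact_mod_cast hN
    calc (1 : ENNReal) = 1 * 1 := by simp
      _ ≤ _ := by gcongr; norm_num
  have he := fun m => measurableEmbedding_addRight (latticeShift d N m)
  refine (lpE_mono_measure (volume_restrict_slab_le N)).trans ?_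
  by_cases h : p = ⊤
  · subst h
    rw [lpE_top, lpE_top]
    refine le_trans ?_ (le_mul_of_one_le_left' hN1)
    refine essSup_le_of_ae_le _ ?_
    rw [EventuallyLE, Measure.ae_sum_iff]
    rintro ⟨m, -⟩
    rw [(he m).ae_map_iff]
    filter_upwards [ENNReal.ae_le_essSup g, ae_restrict_mem (measurableSet_strip hJ)] with z hz hz'
    rwa [hgm z hz']
  · have h0 : 0 < p.toReal := ENNReal.toReal_pos (by positivity) h
    have h1 : 1 ≤ p.toReal := by
      rw [← ENNReal.toReal_one]; exact ENNReal.toReal_mono h hp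
    rw [lpE_of_ne_top h, lpE_of_ne_top h]
    have h2 : (∫⁻ z, g z ^ p.toReal ∂Measure.sum
        fun m : Fintype.piFinset fun _ : Fin d => Finset.range (2 * N) =>
        (volume.restrict (strip d J)).map (fun z => z + latticeShift d N m))
        = (2 * N) ^ d * ∫⁻ z in strip d J, g z ^ p.toReal := by
      rw [lintegral_sum_measure]
      have : ∀ m : Fintype.piFinset fun _ : Fin d => Finset.range (2 * N),
          ∫⁻ z, g z ^ p.toReal ∂((volume.restrict (strip d J)).map fun z => z + latticeShift d N m)
          = ∫⁻ z in strip d J, g z ^ p.toReal := fun m => by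
        rw [(he m).lintegral_map]
        refine setLIntegral_congr_fun (measurableSet_strip hJ) fun z hz => ?_
        simp only [hgm z hz]
      simp only [this]
      rw [tsum_fintype]
      simp
    rw [h2, ENNReal.mul_rpow_of_nonneg _ _ (by positivity)]
    gcongr
    refine (ENNReal.rpow_le_rpow_of_exponent_le hN1 ?_).trans (ENNReal.rpow_one _).le
    rwa [div_le_one h0]

end Slab

section Averages

variable {d : ℕ} {p : ENNReal} {g : (Fin (d + 1) → ℝ) → ENNReal} {J E : Set ℝ}

/-- The points with time in `J` and at spatial distance at most `2 * l` from `z`. -/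
def column (d : ℕ) (J : Set ℝ) (l : ℝ) (z : Fin (d + 1) → ℝ) : Set (Fin (d + 1) → ℝ) :=
  {y | y 0 ∈ J ∧ ∀ i : Fin d, |y i.succ - z i.succ| ≤ 2 * l}

lemma volume_column (J : Set ℝ) (l : ℝ) (z : Fin (d + 1) → ℝ) :
    volume (column d J l z) = volume J * ENNReal.ofReal (4 * l) ^ d := by
  have : column d J l z = Set.univ.pi
      (Fin.cons J fun i : Fin d => Set.Icc (z i.succ - 2 * l) (z i.succ + 2 * l)) := by
    ext y
    simp only [column, abs_le, Set.mem_ofPred_eq, Set.mem_pi, Set.mem_univ, true_imp_iff,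
      Fin.forall_fin_succ, Fin.cons_zero, Fin.cons_succ, Set.mem_Icc]
    refine and_congr_right fun _ => forall_congr' fun i => ?_
    constructor <;> rintro ⟨h1, h2⟩ <;> constructor <;> linarith
  rw [this, volume_pi_pi]
  have h4 : ∀ x : ℝ, x + 2 * l - (x - 2 * l) = 4 * l := fun x => by ring
  simp [Fin.prod_univ_succ, h4]

lemma column_subset_slab {l : ℝ} (hl : l ≤ 1) {z : Fin (d + 1) → ℝ} (hz : z ∈ strip d E) :
    column d J l z ⊆ slab d J 3 := by
  refine fun y hy => ⟨hy.1, fun i => ?_⟩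
  have h1 := abs_le.1 (hy.2 i)
  have h2 := hz.2 i
  push_cast
  constructor <;> linarith [h1.1, h1.2, h2.1, h2.2]

lemma measurableSet_column (hJ : MeasurableSet J) (l : ℝ) (z : Fin (d + 1) → ℝ) :
    MeasurableSet (column d J l z) := by
  have : column d J l z = (fun y => y 0) ⁻¹' J ∩
      ⋂ i : Fin d, {y : Fin (d + 1) → ℝ | |y i.succ - z i.succ| ≤ 2 * l} := by
    ext y; simp [column]
  rw [this]
  refine (measurable_pi_apply 0 hJ).inter (MeasurableSet.iInter fun i => ?_)
  exact measurableSet_le (by fun_prop) measurable_const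

lemma measurableSet_column_prod (hJ : MeasurableSet J) (l : ℝ) :
    MeasurableSet {q : (Fin (d + 1) → ℝ) × (Fin (d + 1) → ℝ) | q.2 ∈ column d J l q.1} := by
  have : {q : (Fin (d + 1) → ℝ) × (Fin (d + 1) → ℝ) | q.2 ∈ column d J l q.1}
      = (fun q : (Fin (d + 1) → ℝ) × (Fin (d + 1) → ℝ) => q.2 0) ⁻¹' J ∩
      ⋂ i : Fin d, {q : (Fin (d + 1) → ℝ) × (Fin (d + 1) → ℝ) |
        |q.2 i.succ - q.1 i.succ| ≤ 2 * l} := by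
    ext y; simp [column]
  rw [this]
  refine MeasurableSet.inter ?_ (MeasurableSet.iInter fun i => ?_)
  · exact (show Measurable fun q : (Fin (d + 1) → ℝ) × (Fin (d + 1) → ℝ) => q.2 0 by fun_prop) hJ
  · exact measurableSet_le (by fun_prop) measurable_const

lemma lintegral_column_swap (hJ : MeasurableSet J) (hE : MeasurableSet E) {l : ℝ} (hl : l ≤ 1)
    {h : (Fin (d + 1) → ℝ) → ENNReal} (hm : Measurable h) :
    ∫⁻ z in strip d E, ∫⁻ y in column d J l z, h y
      ≤ (volume E * ENNReal.ofReal (4 * l) ^ d) * ∫⁻ y in slab d J 3, h y := by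
  set B := {q : (Fin (d + 1) → ℝ) × (Fin (d + 1) → ℝ) | q.2 ∈ column d J l q.1}
  have hB : MeasurableSet B := measurableSet_column_prod hJ l
  calc ∫⁻ z in strip d E, ∫⁻ y in column d J l z, h y
      ≤ ∫⁻ z in strip d E, ∫⁻ y in slab d J 3, B.indicator (fun q => h q.2) (z, y) := by
        refine setLIntegral_mono' (measurableSet_strip hE) fun z hz => ?_
        have : ∫⁻ y in column d J l z, h y
            = ∫⁻ y in column d J l z, B.indicator (fun q => h q.2) (z, y) :=
          setLIntegral_congr_fun (measurableSet_column hJ l z) fun y hy => by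
            rw [Set.indicator_of_mem (show (z, y) ∈ B from hy)]
        rw [this]
        exact lintegral_mono_set (column_subset_slab hl hz)
    _ = ∫⁻ y in slab d J 3, ∫⁻ z in strip d E, B.indicator (fun q => h q.2) (z, y) :=
        lintegral_lintegral_swap ((hm.comp measurable_snd).indicator hB).aemeasurable
    _ ≤ ∫⁻ y in slab d J 3, h y * (volume E * ENNReal.ofReal (4 * l) ^ d) := by
        refine lintegral_mono fun y => ?_
        calc ∫⁻ z in strip d E, B.indicator (fun q => h q.2) (z, y)
            ≤ ∫⁻ z in strip d E, (column d E l y).indicator (fun _ => h y) z := by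
              refine setLIntegral_mono' (measurableSet_strip hE) fun z hz => ?_
              by_cases hq : (z, y) ∈ B
              · rw [Set.indicator_of_mem hq, Set.indicator_of_mem]
                exact ⟨hz.1, fun i => by rw [abs_sub_comm]; exact hq.2 i⟩
              · rw [Set.indicator_of_notMem hq]
                exact zero_le
          _ ≤ ∫⁻ z, (column d E l y).indicator (fun _ => h y) z := setLIntegral_le_lintegral _ _
          _ = _ := by
              rw [lintegral_indicator_const (measurableSet_column hE l y), volume_column]
    _ = _ := by rw [lintegral_mul_const _ hm, mul_comm]

lemma measurable_lintegral_column (hJ : MeasurableSet J) (l : ℝ)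
    {h : (Fin (d + 1) → ℝ) → ENNReal} (hm : Measurable h) :
    Measurable fun z => ∫⁻ y in column d J l z, h y := by
  have : (fun z => ∫⁻ y in column d J l z, h y) = fun z => ∫⁻ y,
      {q : (Fin (d + 1) → ℝ) × (Fin (d + 1) → ℝ) | q.2 ∈ column d J l q.1}.indicator
        (fun q => h q.2) (z, y) := by
    ext z
    rw [← lintegral_indicator (measurableSet_column hJ l z)]
    rfl
  rw [this]
  exact Measurable.lintegral_prod_right'
    ((hm.comp measurable_snd).indicator (measurableSet_column_prod hJ l))

/-- Integrals over columns, as a function of the base point of the column. -/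
lemma exists_columnIntegral (hp : 1 ≤ p) (hJ : MeasurableSet J) (hE : MeasurableSet E)
    (hg : PeriodicAt d J g) {l : ℝ} (hl : l ≤ 1) :
    ∃ a : (Fin (d + 1) → ℝ) → ENNReal, Measurable a ∧
      (∀ z, ∫⁻ y in column d J l z, g y = a z) ∧
      lpE d (volume.restrict (strip d E)) p a
        ≤ (volume J * ENNReal.ofReal (4 * l) ^ d) ^ (1 - p⁻¹.toReal)
          * (volume E * ENNReal.ofReal (4 * l) ^ d) ^ p⁻¹.toReal
          * (6 ^ d * lpE d (volume.restrict (strip d J)) p g) := by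
  obtain ⟨h, hm, hle, heq⟩ := exists_measurable_le_forall_setLIntegral_eq volume g
  refine ⟨fun z => ∫⁻ y in column d J l z, h y, measurable_lintegral_column hJ l hm,
    fun z => heq _, ?_⟩
  have hbase : lpE d (volume.restrict (slab d J 3)) p h
      ≤ 6 ^ d * lpE d (volume.restrict (strip d J)) p g := by
    refine (lpE_mono hle).trans ((lpE_slab_le hp hJ hg (by norm_num)).trans (le_of_eq ?_))
    norm_num
  have hcol : ∀ z, ∫⁻ y in column d J l z, h y
      ≤ (volume J * ENNReal.ofReal (4 * l) ^ d) ^ (1 - p⁻¹.toReal)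
        * lpE d (volume.restrict (column d J l z)) p h := fun z => by
    rw [← volume_column J l z, mul_comm]
    exact setLIntegral_le_lpE hp _
  rw [mul_assoc]
  generalize (volume J * ENNReal.ofReal (4 * l) ^ d) ^ (1 - p⁻¹.toReal) = V at hcol ⊢
  by_cases htop : p = ⊤
  · subst htop
    simp only [ENNReal.inv_top, ENNReal.toReal_zero, ENNReal.rpow_zero, one_mul]
    rw [lpE_top]
    refine essSup_le_of_ae_le _ ?_
    filter_upwards [ae_restrict_mem (measurableSet_strip hE)] with z hz
    refine (hcol z).trans ?_
    gcongr
    refine (lpE_mono_measure ?_).trans hbase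
    exact Measure.restrict_mono (column_subset_slab hl hz) le_rfl
  · have h0 : 0 < p.toReal := ENNReal.toReal_pos (by positivity) htop
    have hq : p⁻¹.toReal = p.toReal⁻¹ := by rw [ENNReal.toReal_inv]
    have hpow : ∀ z, (∫⁻ y in column d J l z, h y) ^ p.toReal
        ≤ V ^ p.toReal * ∫⁻ y in column d J l z, h y ^ p.toReal := fun z => by
      refine (ENNReal.rpow_le_rpow (hcol z) h0.le).trans (le_of_eq ?_)
      rw [lpE_of_ne_top htop, ENNReal.mul_rpow_of_nonneg _ _ h0.le, ← ENNReal.rpow_mul,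
        one_div_mul_cancel h0.ne', ENNReal.rpow_one]
    rw [lpE_of_ne_top htop] at hbase
    rw [lpE_of_ne_top htop, hq]
    calc (∫⁻ z in strip d E, (∫⁻ y in column d J l z, h y) ^ p.toReal) ^ (1 / p.toReal)
        ≤ (V ^ p.toReal * ((volume E * ENNReal.ofReal (4 * l) ^ d)
            * ∫⁻ y in slab d J 3, h y ^ p.toReal)) ^ (1 / p.toReal) := by
          refine ENNReal.rpow_le_rpow ?_ (by positivity)
          refine (lintegral_mono hpow).trans ?_
          rw [lintegral_const_mul _ (measurable_lintegral_column hJ l (hm.pow_const _))]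
          gcongr
          exact lintegral_column_swap hJ hE hl (hm.pow_const _)
      _ = V * ((volume E * ENNReal.ofReal (4 * l) ^ d) ^ p.toReal⁻¹
            * (∫⁻ y in slab d J 3, h y ^ p.toReal) ^ (1 / p.toReal)) := by
          rw [ENNReal.mul_rpow_of_nonneg _ _ (by positivity),
            ENNReal.mul_rpow_of_nonneg _ _ (by positivity), ← ENNReal.rpow_mul,
            mul_one_div_cancel h0.ne', ENNReal.rpow_one, one_div]
      _ ≤ _ := by gcongr

end Averages

section Estimates

variable {d r : ℕ} {p : ENNReal} {S : Set (Fin (d + 1) → ℝ)}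
  {η : ((Fin (d + 1) → ℝ) → ℝ) → ℝ} {J : Set ℝ}

lemma bNorm_eq (hp : 1 ≤ p) (ν l : ℝ) :
    bNorm d r p ν η l J
      = ENNReal.ofReal (l ^ (-ν)) * lpE d (volume.restrict (strip d J)) p (supBr d r η l) :=
  lpE_const_mul hp ENNReal.ofReal_ne_top

lemma bNorm_le_iff (hp : 1 ≤ p) {ν l : ℝ} (hl : 0 < l) {K : ENNReal} :
    bNorm d r p ν η l J ≤ K
      ↔ lpE d (volume.restrict (strip d J)) p (supBr d r η l) ≤ K * ENNReal.ofReal (l ^ ν) := by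
  have h : 0 < l ^ (-ν) := Real.rpow_pos_of_pos hl _
  rw [bNorm_eq hp, mul_comm, ← ENNReal.le_div_iff_mul_le (Or.inl (by simpa using h))
    (Or.inl ENNReal.ofReal_ne_top), div_eq_mul_inv, ← ENNReal.ofReal_inv_of_pos h,
    Real.rpow_neg hl.le, inv_inv]

lemma periodicAt_supBr (hη : PeriodicOn d r S η) {l : ℝ} (hl : 0 < l)
    (h : ∀ z : Fin (d + 1) → ℝ, z 0 ∈ J →
      ∀ y : Fin (d + 1) → ℝ, (∀ i, |y i - z i| ≤ l ^ sE d i) → y ∈ S) :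
    PeriodicAt d J (supBr d r η l) := by
  intro z hz m
  refine iSup_congr fun φ => iSup_congr fun hφ => ?_
  rw [← hη m _ (isTest_testScale hl hφ (h z hz))]
  congr 3
  ext y
  simp only [testScale]
  congr 3
  abel

lemma exists_slab_bound (d r : ℕ) : ∃ C : ℝ, 0 < C ∧ ∀ (p : ENNReal), 1 ≤ p →
    ∀ (S : Set (Fin (d + 1) → ℝ)) (η : ((Fin (d + 1) → ℝ) → ℝ) → ℝ), LinOn d r S η →
    ∀ f, IsTest d r S f → ∀ l A : ℝ, 0 < l → 0 < A → DerivBound d r l A f →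
    ∀ (J : Set ℝ) (N : ℕ), MeasurableSet J → 1 ≤ N → PeriodicAt d J (supBr d r η l) →
      (∀ y ∈ tsupport f, ∀ z : Fin (d + 1) → ℝ, (∀ i, |y i - z i| ≤ l ^ sE d i) →
        z ∈ slab d J N) →
      ENNReal.ofReal |η f| ≤ ENNReal.ofReal (C * A) *
        ((2 * N) ^ d * lpE d (volume.restrict (strip d J)) p (supBr d r η l)
          * (volume J * (2 * N) ^ d) ^ (1 - p⁻¹.toReal)) := by
  obtain ⟨C, hC, h⟩ := exists_grid_bound d r
  refine ⟨C, hC, fun p hp S η hη f hf l A hl hA hb J N hJ hN hper hs => ?_⟩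
  refine (h S η hη f hf l A hl hA hb _ hs).trans ?_
  gcongr
  refine (setLIntegral_le_lpE hp _).trans ?_
  rw [volume_slab]
  gcongr
  exact lpE_slab_le hp hJ hper hN

end Estimates

section Cut

/-- A smooth cutoff, vanishing at times below `20 * l ^ 2`, equal to `1` above `21 * l ^ 2`. -/
def timeCut (d : ℕ) (l : ℝ) (y : Fin (d + 1) → ℝ) : ℝ := Real.smoothTransition (y 0 / l ^ 2 - 20)

/-- The difference of two successive dyadic time cutoffs. -/
def timeLayer (d : ℕ) (l : ℝ) (y : Fin (d + 1) → ℝ) : ℝ := timeBump 4 20 20 (y 0 / l ^ 2)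

variable {d r : ℕ} {l : ℝ} {y : Fin (d + 1) → ℝ}

lemma timeCut_half : timeCut d (l / 2) = timeCut d l + timeLayer d l := by
  ext y
  have : y 0 / (l / 2) ^ 2 = 4 * (y 0 / l ^ 2) := by ring
  simp only [timeCut, timeLayer, timeBump, this, Pi.add_apply]
  ring

lemma contDiff_timeCut {n : ℕ∞} : ContDiff ℝ n (timeCut d l) :=
  Real.smoothTransition.contDiff.comp (by fun_prop)

lemma contDiff_timeLayer {n : ℕ∞} : ContDiff ℝ n (timeLayer d l) :=
  (contDiff_timeBump 4 20 20).comp (by fun_prop)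

lemma timeCut_eq_zero (hl : 0 < l) (h : y 0 ≤ 20 * l ^ 2) : timeCut d l y = 0 := by
  refine Real.smoothTransition.zero_of_nonpos ?_
  rw [sub_nonpos, div_le_iff₀ (by positivity)]
  exact h

lemma timeCut_eq_one (hl : 0 < l) (h : 21 * l ^ 2 ≤ y 0) : timeCut d l y = 1 := by
  refine Real.smoothTransition.one_of_one_le ?_
  rw [le_sub_iff_add_le, le_div_iff₀ (by positivity)]
  linarith

lemma le_of_mem_tsupport_timeCut (hl : 0 < l) (hy : y ∈ tsupport (timeCut d l)) :
    20 * l ^ 2 ≤ y 0 := by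
  refine tsupport_subset_of_ne_zero (s := {y : Fin (d + 1) → ℝ | 20 * l ^ 2 ≤ y 0})
    (isClosed_le continuous_const (continuous_apply 0)) (fun y hy => ?_) hy
  by_contra h
  exact hy (timeCut_eq_zero hl (not_le.1 h).le)

lemma mem_of_mem_tsupport_timeLayer (hl : 0 < l) (hy : y ∈ tsupport (timeLayer d l)) :
    5 * l ^ 2 ≤ y 0 ∧ y 0 ≤ 21 * l ^ 2 := by
  have hl2 : 0 < l ^ 2 := by positivity
  refine tsupport_subset_of_ne_zero
    (s := {y : Fin (d + 1) → ℝ | 5 * l ^ 2 ≤ y 0 ∧ y 0 ≤ 21 * l ^ 2})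
    ((isClosed_le continuous_const (continuous_apply 0)).inter
      (isClosed_le (continuous_apply 0) continuous_const)) (fun y hy => ?_) hy
  by_contra h
  refine hy (timeBump_eq_zero ?_)
  simp only [Set.mem_ofPred_eq, not_and_or, not_le] at h
  rcases h with h | h
  · left
    have : y 0 / l ^ 2 < 5 := by rwa [div_lt_iff₀ hl2]
    constructor <;> linarith
  · right
    have : 21 < y 0 / l ^ 2 := by rwa [lt_div_iff₀ hl2]
    constructor <;> linarith

lemma IsTest.mul_timeCut {T : ℝ} {φ : (Fin (d + 1) → ℝ) → ℝ} (hφ : IsTest d r (S1 d T) φ)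
    (hl : 0 < l) : IsTest d r (S0 d T) (φ * timeCut d l) := by
  refine (hφ.mul_right contDiff_timeCut).mono fun y hy => Or.inr ⟨?_, ?_⟩
  · have := le_of_mem_tsupport_timeCut hl (tsupport_mul_subset_right hy)
    have : 0 < l ^ 2 := by positivity
    linarith
  · exact hφ.2.2 (tsupport_mul_subset_left hy)

lemma IsTest.mul_timeLayer {T : ℝ} {φ : (Fin (d + 1) → ℝ) → ℝ} (hφ : IsTest d r (S1 d T) φ)
    (hl : 0 < l) : IsTest d r (S0 d T) (φ * timeLayer d l) := by
  refine (hφ.mul_right contDiff_timeLayer).mono fun y hy => Or.inr ⟨?_, ?_⟩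
  · have := (mem_of_mem_tsupport_timeLayer hl (tsupport_mul_subset_right hy)).1
    have : 0 < l ^ 2 := by positivity
    linarith
  · exact hφ.2.2 (tsupport_mul_subset_left hy)

lemma exists_layer_bound (d r : ℕ) : ∃ C : ℝ, 0 < C ∧
    ∀ (T : ℝ) (ξ : ((Fin (d + 1) → ℝ) → ℝ) → ℝ), LinOn d r (S0 d T) ξ →
    ∀ φ, IsTest d r (S1 d T) φ → ∀ l m A : ℝ, 0 < m → m ≤ l → 0 < A → DerivBound d r l A φ →
    ∀ W : Set (Fin (d + 1) → ℝ),
      (∀ y ∈ tsupport φ, ∀ z : Fin (d + 1) → ℝ, z 0 ∈ Set.Icc (4 * m ^ 2) (22 * m ^ 2) →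
        (∀ i, |y i - z i| ≤ m ^ sE d i) → z ∈ W) →
      ENNReal.ofReal |ξ (φ * timeLayer d m)|
        ≤ ENNReal.ofReal (C * A) * ∫⁻ z in W, supBr d r ξ m z := by
  obtain ⟨C, hC, h⟩ := exists_grid_bound d r
  obtain ⟨B, hB, hb⟩ := exists_derivBound_timeBump d r (show (0 : ℝ) < 4 by norm_num) 20 20
  refine ⟨C * (2 ^ r * B), by positivity, fun T ξ hξ φ hφ l m A hm hml hA hφb W hW => ?_⟩
  have := h (S0 d T) ξ hξ _ (hφ.mul_timeLayer hm) m (2 ^ r * (A * B)) hm (by positivity)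
    ((hφb.mono_scale hm.le hml).mul hm (hb m hm) hφ.1 contDiff_timeLayer) W fun y hy z hz => ?_
  · refine this.trans (le_of_eq ?_)
    congr 2
    ring
  · have h1 := mem_of_mem_tsupport_timeLayer hm (tsupport_mul_subset_right hy)
    refine hW y (tsupport_mul_subset_left hy) z ?_ hz
    have h2 := abs_le.1 (hz 0)
    rw [sE_zero] at h2
    constructor <;> linarith [h2.1, h2.2]

end Cut

/-- A periodic distribution away from time zero, vanishing at negative times, with the size of
order `ν` up to distances to time zero comparable to the scale. -/
structure IsPunctured (d r : ℕ) (p : ENNReal) (ν T : ℝ) (ξ : ((Fin (d + 1) → ℝ) → ℝ) → ℝ)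
    (K : ENNReal) : Prop where
  one_le : 1 ≤ p
  pos : 0 < 2 * (1 - p⁻¹.toReal) + ν
  linOn : LinOn d r (S0 d T) ξ
  periodicOn : PeriodicOn d r (S0 d T) ξ
  eq_zero : ∀ φ, IsTest d r (S0 d T) φ → tsupport φ ⊆ {z | z 0 < 0} → ξ φ = 0
  ne_top : K ≠ ⊤
  bound : ∀ l : ℝ, 0 < l → l ≤ 1 →
    lpE d (volume.restrict (strip d (Set.Ioo (3 * l ^ 2) (T - l ^ 2)))) p (supBr d r ξ l)
      ≤ K * ENNReal.ofReal (l ^ ν)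

section Extension

variable {d r : ℕ} {p : ENNReal} {ν T : ℝ} {ξ : ((Fin (d + 1) → ℝ) → ℝ) → ℝ} {K : ENNReal}
  {lam : ℝ}

lemma inv_toReal_le_one (hp : 1 ≤ p) : p⁻¹.toReal ≤ 1 := by
  rw [← ENNReal.toReal_one]
  exact ENNReal.toReal_mono ENNReal.one_ne_top (ENNReal.inv_le_one.2 hp)

lemma PeriodicOn.periodicAt_S0 (hξ : PeriodicOn d r (S0 d T) ξ) {l : ℝ} (hl : 0 < l) :
    PeriodicAt d (Set.Ioo (3 * l ^ 2) (T - l ^ 2)) (supBr d r ξ l) :=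
  periodicAt_supBr hξ hl fun z hz y hy => by
    have h := abs_le.1 (hy 0)
    rw [sE_zero] at h
    have : 0 < l ^ 2 := by positivity
    exact Or.inr ⟨by linarith [h.1, hz.1], by linarith [h.2, hz.2]⟩

lemma PeriodicOn.periodicAt_S1 (hξ : PeriodicOn d r (S1 d T) ξ) {l : ℝ} (hl : 0 < l) :
    PeriodicAt d (Set.Iio (T - l ^ 2)) (supBr d r ξ l) :=
  periodicAt_supBr hξ hl fun z hz y hy => by
    have h := abs_le.1 (hy 0)
    rw [sE_zero] at h
    show y 0 < T
    linarith [h.2, Set.mem_Iio.1 hz]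

lemma layer_subset {m : ℝ} (hm : 0 < m) (hlam : 23 * lam ^ 2 < T) (hml : m ≤ lam) :
    Set.Icc (4 * m ^ 2) (22 * m ^ 2) ⊆ Set.Ioo (3 * m ^ 2) (T - m ^ 2) := by
  intro t ht
  have h1 : m ^ 2 ≤ lam ^ 2 := by gcongr
  have : 0 < m ^ 2 := by positivity
  exact ⟨by linarith [ht.1], by linarith [ht.2]⟩

lemma ofReal_rpow_mul_rpow {b m ν q : ℝ} (hb : 0 ≤ b) (hm : 0 < m) (hq : 0 ≤ q) (c : ENNReal) :
    ENNReal.ofReal (m ^ ν) * (ENNReal.ofReal (b * m ^ 2) * c) ^ q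
      = (ENNReal.ofReal b * c) ^ q * ENNReal.ofReal (m ^ (2 * q + ν)) := by
  have h1 : ENNReal.ofReal (b * m ^ 2) * c = (ENNReal.ofReal b * c) * ENNReal.ofReal (m ^ 2) := by
    rw [ENNReal.ofReal_mul hb]; ring
  rw [h1, ENNReal.mul_rpow_of_nonneg _ _ hq, ENNReal.ofReal_rpow_of_nonneg (by positivity) hq,
    mul_left_comm, ← ENNReal.ofReal_mul (by positivity)]
  congr 2
  rw [← Real.rpow_natCast, ← Real.rpow_mul hm.le, ← Real.rpow_add hm]
  congr 1
  push_cast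
  ring

lemma IsPunctured.exists_layer_bound (h : IsPunctured d r p ν T ξ K) (hlam1 : lam ≤ 1)
    (hlam : 23 * lam ^ 2 < T) {N : ℕ} (hN : 1 ≤ N) : ∃ C : ENNReal, C ≠ ⊤ ∧
      ∀ φ, IsTest d r (S1 d T) φ → (∀ y ∈ tsupport φ, ∀ i : Fin d, |y i.succ| + 2 ≤ N) →
      ∀ l m A : ℝ, 0 < m → m ≤ l → m ≤ lam → 0 < A → DerivBound d r l A φ →
      ENNReal.ofReal |ξ (φ * timeLayer d m)|
        ≤ ENNReal.ofReal A * C * ENNReal.ofReal (m ^ (2 * (1 - p⁻¹.toReal) + ν)) := by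
  obtain ⟨C, hC, hb⟩ := _root_.exists_layer_bound d r
  have hq : 0 ≤ 1 - p⁻¹.toReal := sub_nonneg.2 (inv_toReal_le_one h.one_le)
  refine ⟨ENNReal.ofReal C * ((2 * N) ^ d * K *
    (ENNReal.ofReal 18 * (2 * N) ^ d) ^ (1 - p⁻¹.toReal)), ?_,
    fun φ hφ hφN l m A hm hml hmlam hA hφb => ?_⟩
  · have := h.ne_top
    finiteness
  · have hslab : ∀ y ∈ tsupport φ, ∀ z : Fin (d + 1) → ℝ,
        z 0 ∈ Set.Icc (4 * m ^ 2) (22 * m ^ 2) → (∀ i, |y i - z i| ≤ m ^ sE d i) →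
        z ∈ slab d (Set.Icc (4 * m ^ 2) (22 * m ^ 2)) N := by
      refine fun y hy z hz hyz => ⟨hz, fun i => ?_⟩
      have h1 := hφN y hy i
      have h2 := abs_le.1 (hyz i.succ)
      rw [sE_succ, pow_one] at h2
      have h3 := neg_abs_le (y i.succ)
      have h4 := le_abs_self (y i.succ)
      constructor <;> linarith [h2.1, h2.2]
    refine (hb T ξ h.linOn φ hφ l m A hm hml hA hφb _ hslab).trans ?_
    have hJ := layer_subset hm hlam hmlam
    have h1 := setLIntegral_le_lpE (g := supBr d r ξ m) h.one_le
      (slab d (Set.Icc (4 * m ^ 2) (22 * m ^ 2)) N)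
    have h2 := lpE_slab_le h.one_le measurableSet_Icc
      ((h.periodicOn.periodicAt_S0 hm).mono hJ) hN
    have h3 : lpE d (volume.restrict (strip d (Set.Icc (4 * m ^ 2) (22 * m ^ 2)))) p
        (supBr d r ξ m) ≤ K * ENNReal.ofReal (m ^ ν) := by
      refine (lpE_mono_measure (Measure.restrict_mono ?_ le_rfl)).trans
        (h.bound m hm (hmlam.trans hlam1))
      exact fun z hz => ⟨hJ hz.1, hz.2⟩
    have h4 : (22 * m ^ 2 - 4 * m ^ 2) = 18 * m ^ 2 := by ring
    rw [volume_slab, Real.volume_Icc, h4] at h1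
    calc _ ≤ ENNReal.ofReal (C * A) * ((2 * N) ^ d * (K * ENNReal.ofReal (m ^ ν))
          * (ENNReal.ofReal (18 * m ^ 2) * (2 * N) ^ d) ^ (1 - p⁻¹.toReal)) := by
          gcongr
          exact h1.trans (by gcongr; exact h2.trans (by gcongr))
      _ = ENNReal.ofReal (C * A) * ((2 * N) ^ d * K * (ENNReal.ofReal (m ^ ν)
          * (ENNReal.ofReal (18 * m ^ 2) * (2 * N) ^ d) ^ (1 - p⁻¹.toReal))) := by ring
      _ = _ := by
          rw [ofReal_rpow_mul_rpow (by norm_num) hm hq, ENNReal.ofReal_mul hC.le]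
          ring

lemma exists_forall_abs_add_le {f : (Fin (d + 1) → ℝ) → ℝ} (hf : HasCompactSupport f) :
    ∃ N : ℕ, 1 ≤ N ∧ ∀ y ∈ tsupport f, ∀ i, |y i| + 2 ≤ N := by
  obtain ⟨N, hN⟩ := exists_forall_box hf 1
  refine ⟨N + 2, by omega, fun y hy i => ?_⟩
  have := hN y hy i
  rw [one_pow, div_one, abs_mul] at this
  push_cast
  norm_num at this
  linarith [abs_nonneg (y i)]

/-- The extension of a functional across time zero, by letting the time cutoffs tend to `1`. -/
def cutExtension (d : ℕ) (ξ : ((Fin (d + 1) → ℝ) → ℝ) → ℝ) (lam : ℝ)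
    (φ : (Fin (d + 1) → ℝ) → ℝ) : ℝ :=
  limUnder atTop fun n : ℕ => ξ (φ * timeCut d (lam / 2 ^ n))

lemma IsPunctured.map_mul_timeCut_succ (h : IsPunctured d r p ν T ξ K) (hl : 0 < lam)
    {φ : (Fin (d + 1) → ℝ) → ℝ} (hφ : IsTest d r (S1 d T) φ) (n : ℕ) :
    ξ (φ * timeCut d (lam / 2 ^ (n + 1)))
      = ξ (φ * timeCut d (lam / 2 ^ n)) + ξ (φ * timeLayer d (lam / 2 ^ n)) := by
  have hn : 0 < lam / 2 ^ n := by positivity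
  have : lam / 2 ^ (n + 1) = lam / 2 ^ n / 2 := by rw [pow_succ, div_div]
  rw [this, timeCut_half, mul_add, h.linOn.1 _ _ (hφ.mul_timeCut hn) (hφ.mul_timeLayer hn)]

lemma div_two_pow_rpow (hl : 0 < lam) (γ : ℝ) (n : ℕ) :
    (lam / 2 ^ n) ^ γ = lam ^ γ * ((2 : ℝ) ^ (-γ)) ^ n := by
  rw [Real.div_rpow hl.le (by positivity), div_eq_mul_inv, Real.rpow_neg (by norm_num), inv_pow,
    ← Real.rpow_natCast, ← Real.rpow_natCast, ← Real.rpow_mul (by norm_num),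
    ← Real.rpow_mul (by norm_num), mul_comm γ]

lemma div_two_pow_le (hl : 0 < lam) (n : ℕ) : lam / 2 ^ n ≤ lam :=
  div_le_self hl.le (one_le_pow₀ (by norm_num))

lemma IsPunctured.tendsto_cutExtension (h : IsPunctured d r p ν T ξ K) (hl : 0 < lam)
    (hlam1 : lam ≤ 1) (hlam : 23 * lam ^ 2 < T)
    {φ : (Fin (d + 1) → ℝ) → ℝ} (hφ : IsTest d r (S1 d T) φ) :
    Tendsto (fun n : ℕ => ξ (φ * timeCut d (lam / 2 ^ n))) atTop (𝓝 (cutExtension d ξ lam φ)) := by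
  obtain ⟨N, hN1, hN⟩ := exists_forall_abs_add_le hφ.2.1
  obtain ⟨A, hA, hφb⟩ := exists_derivBound hφ.1 hφ.2.1
  obtain ⟨C, hC, hb⟩ := h.exists_layer_bound hlam1 hlam hN1
  set γ := 2 * (1 - p⁻¹.toReal) + ν
  have hγ : 0 < γ := h.pos
  refine CauchySeq.tendsto_limUnder (cauchySeq_of_le_geometric ((2 : ℝ) ^ (-γ))
    ((ENNReal.ofReal A * C).toReal * lam ^ γ) ?_ fun n => ?_)
  · exact Real.rpow_lt_one_of_one_lt_of_neg (by norm_num) (by linarith)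
  · have hn : 0 < lam / 2 ^ n := by positivity
    have hnl := div_two_pow_le hl n
    have := hb φ hφ (fun y hy i => hN y hy i.succ) 1 _ A hn (hnl.trans hlam1) hnl hA hφb
    rw [← ENNReal.ofReal_toReal (show ENNReal.ofReal A * C ≠ ⊤ by finiteness),
      ← ENNReal.ofReal_mul (by positivity), ENNReal.ofReal_le_ofReal_iff (by positivity),
      div_two_pow_rpow hl] at this
    rw [h.map_mul_timeCut_succ hl hφ, dist_eq_norm, sub_add_cancel_left, norm_neg, mul_assoc]
    exact this

lemma IsPunctured.ofReal_abs_cutExtension_le (h : IsPunctured d r p ν T ξ K) (hl : 0 < lam)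
    (hlam1 : lam ≤ 1) (hlam : 23 * lam ^ 2 < T)
    {φ : (Fin (d + 1) → ℝ) → ℝ} (hφ : IsTest d r (S1 d T) φ) (m : ℕ) :
    ENNReal.ofReal |cutExtension d ξ lam φ| ≤ ENNReal.ofReal |ξ (φ * timeCut d (lam / 2 ^ m))|
      + ∑' k : ℕ, ENNReal.ofReal |ξ (φ * timeLayer d (lam / 2 ^ (m + k)))| := by
  have ht := (tendsto_add_atTop_iff_nat m).2 (h.tendsto_cutExtension hl hlam1 hlam hφ)
  have ht' := (ENNReal.continuous_ofReal.comp continuous_abs).continuousAt.tendsto.comp ht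
  refine le_of_tendsto' ht' fun n => ?_
  have : ∀ n, ENNReal.ofReal |ξ (φ * timeCut d (lam / 2 ^ (n + m)))|
      ≤ ENNReal.ofReal |ξ (φ * timeCut d (lam / 2 ^ m))|
      + ∑ k ∈ Finset.range n, ENNReal.ofReal |ξ (φ * timeLayer d (lam / 2 ^ (m + k)))| := by
    intro n
    induction n with
    | zero => simp
    | succ n ih =>
      rw [Finset.sum_range_succ, ← add_assoc, show n + 1 + m = n + m + 1 by ring,
        h.map_mul_timeCut_succ hl hφ, add_comm m n]
      refine (ENNReal.ofReal_le_ofReal (abs_add_le _ _)).trans ?_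
      rw [ENNReal.ofReal_add (abs_nonneg _) (abs_nonneg _)]
      gcongr
  exact (this n).trans (by gcongr; exact ENNReal.sum_le_tsum _)

lemma IsPunctured.cutExtension_eq_zero (h : IsPunctured d r p ν T ξ K) (hl : 0 < lam)
    {φ : (Fin (d + 1) → ℝ) → ℝ} (hφ : ∀ y ∈ tsupport φ, y 0 ≤ 0) : cutExtension d ξ lam φ = 0 := by
  have : ∀ n : ℕ, ξ (φ * timeCut d (lam / 2 ^ n)) = 0 := fun n => by
    have : φ * timeCut d (lam / 2 ^ n) = 0 := by
      ext y
      by_cases hy : y ∈ tsupport φ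
      · simp [timeCut_eq_zero (show 0 < lam / 2 ^ n by positivity)
          ((hφ y hy).trans (by positivity))]
      · simp [image_eq_zero_of_notMem_tsupport hy]
    rw [this, h.linOn.map_zero]
  simp only [cutExtension, this]
  exact tendsto_const_nhds.limUnder_eq

lemma IsPunctured.linOn_cutExtension (h : IsPunctured d r p ν T ξ K) (hl : 0 < lam)
    (hlam1 : lam ≤ 1) (hlam : 23 * lam ^ 2 < T) : LinOn d r (S1 d T) (cutExtension d ξ lam) := by
  have hn : ∀ n : ℕ, 0 < lam / 2 ^ n := fun n => by positivity
  constructor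
  · intro φ ψ hφ hψ
    have h1 := (h.tendsto_cutExtension hl hlam1 hlam hφ).add
      (h.tendsto_cutExtension hl hlam1 hlam hψ)
    refine tendsto_nhds_unique (h.tendsto_cutExtension hl hlam1 hlam (hφ.add hψ)) (h1.congr ?_)
    intro n
    rw [add_mul, h.linOn.1 _ _ (hφ.mul_timeCut (hn n)) (hψ.mul_timeCut (hn n))]
  · intro c φ hφ
    have h1 := (h.tendsto_cutExtension hl hlam1 hlam hφ).const_mul c
    refine tendsto_nhds_unique (h.tendsto_cutExtension hl hlam1 hlam (hφ.smul c)) (h1.congr ?_)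
    intro n
    rw [smul_mul_assoc, h.linOn.2 _ _ (hφ.mul_timeCut (hn n))]

lemma IsTest.comp_sub {S : Set (Fin (d + 1) → ℝ)} {φ : (Fin (d + 1) → ℝ) → ℝ}
    (hφ : IsTest d r S φ) {v : Fin (d + 1) → ℝ} (hS : ∀ y, y - v ∈ S → y ∈ S) :
    IsTest d r S fun y => φ (y - v) := by
  refine ⟨hφ.1.comp (contDiff_id.sub contDiff_const),
    hφ.2.1.comp_homeomorph (Homeomorph.subRight v), ?_⟩
  intro y hy
  refine hS y (hφ.2.2 ?_)
  exact tsupport_comp_subset_preimage φ (f := fun y => y - v) (by fun_prop) hy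

lemma IsPunctured.periodicOn_cutExtension (h : IsPunctured d r p ν T ξ K) (hl : 0 < lam)
    (hlam1 : lam ≤ 1) (hlam : 23 * lam ^ 2 < T) :
    PeriodicOn d r (S1 d T) (cutExtension d ξ lam) := by
  intro m φ hφ
  have h1 := hφ.comp_sub (v := Fin.cons (0 : ℝ) fun i => (m i : ℝ)) fun y hy => by
    simpa [S1] using hy
  refine tendsto_nhds_unique (h.tendsto_cutExtension hl hlam1 hlam h1)
    ((h.tendsto_cutExtension hl hlam1 hlam hφ).congr fun n => ?_)
  rw [← h.periodicOn m _ (hφ.mul_timeCut (show 0 < lam / 2 ^ n by positivity))]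
  congr 1
  ext y
  simp [timeCut]

lemma IsPunctured.map_mul_timeCut_eq (h : IsPunctured d r p ν T ξ K)
    {φ : (Fin (d + 1) → ℝ) → ℝ} (hφ : IsTest d r (S0 d T) φ) {m : ℝ} (hm : 0 < m)
    (hφm : ∀ y ∈ tsupport φ, 0 ≤ y 0 → 21 * m ^ 2 ≤ y 0) : ξ (φ * timeCut d m) = ξ φ := by
  have h1 : IsTest d r (S0 d T) (φ * timeCut d m) := hφ.mul_right contDiff_timeCut
  obtain ⟨h2, h3⟩ := h.linOn.map_sub hφ h1
  have : ξ (φ - φ * timeCut d m) = 0 := by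
    refine h.eq_zero _ h2 fun y hy => ?_
    have hy' : y ∈ tsupport φ ∩ {y | y 0 ≤ 0} := by
      refine tsupport_subset_of_ne_zero ((isClosed_tsupport φ).inter
        (isClosed_le (continuous_apply 0) continuous_const)) (fun y hy => ?_) hy
      have hy1 : y ∈ tsupport φ := by
        by_contra hy1
        exact hy (by simp [image_eq_zero_of_notMem_tsupport hy1])
      refine ⟨hy1, ?_⟩
      by_contra hy2
      refine hy ?_
      simp [timeCut_eq_one hm (hφm y hy1 (not_le.1 hy2).le)]
    rcases h2.2.2 hy with h4 | h4
    · exact h4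
    · exact absurd hy'.2 (not_le.2 h4.1)
  linarith

lemma IsPunctured.cutExtension_eq (h : IsPunctured d r p ν T ξ K) (hl : 0 < lam)
    {φ : (Fin (d + 1) → ℝ) → ℝ} (hφ : IsTest d r (S0 d T) φ) : cutExtension d ξ lam φ = ξ φ := by
  obtain ⟨δ, hδ, hφδ⟩ : ∃ δ > 0, ∀ y ∈ tsupport φ, 0 ≤ y 0 → δ ≤ y 0 := by
    have hc : IsCompact (tsupport φ ∩ {y | 0 ≤ y 0}) :=
      IsCompact.inter_right hφ.2.1 (isClosed_le continuous_const (continuous_apply 0))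
    rcases (tsupport φ ∩ {y | 0 ≤ y 0}).eq_empty_or_nonempty with he | hne
    · refine ⟨1, one_pos, fun y hy hy0 => ?_⟩
      exact absurd (show y ∈ tsupport φ ∩ {y | 0 ≤ y 0} from ⟨hy, hy0⟩) (by simp [he])
    · obtain ⟨y, hy, hmin⟩ := hc.exists_isMinOn hne (continuous_apply 0).continuousOn
      refine ⟨y 0, ?_, fun z hz hz0 => hmin ⟨hz, hz0⟩⟩
      rcases hφ.2.2 hy.1 with h4 | h4
      · exact absurd hy.2 (not_le.2 h4)
      · exact h4.1
  have hlim : Tendsto (fun n : ℕ => 21 * (lam / 2 ^ n) ^ 2) atTop (𝓝 0) := by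
    have h1 : Tendsto (fun n : ℕ => lam * ((1 : ℝ) / 2) ^ n) atTop (𝓝 (lam * 0)) :=
      (tendsto_pow_atTop_nhds_zero_of_lt_one (by norm_num) (by norm_num)).const_mul lam
    have h2 := (h1.pow 2).const_mul 21
    simpa [div_eq_mul_inv] using h2
  refine Tendsto.limUnder_eq (tendsto_const_nhds.congr' ?_)
  filter_upwards [hlim.eventually (gt_mem_nhds hδ)] with n hn
  exact (h.map_mul_timeCut_eq hφ (by positivity) fun y hy hy0 => hn.le.trans (hφδ y hy hy0)).symm

end Extension

section Uniqueness

variable {d r : ℕ} {p : ENNReal} {ν T : ℝ} {ξ η : ((Fin (d + 1) → ℝ) → ℝ) → ℝ} {K L : ENNReal}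
  {lam : ℝ}

/-- A smooth cutoff to times between `- 2 * l ^ 2` and `21 * l ^ 2`. -/
def timeCore (d : ℕ) (l : ℝ) (y : Fin (d + 1) → ℝ) : ℝ := timeBump 1 (-2) 20 (y 0 / l ^ 2)

lemma contDiff_timeCore {l : ℝ} {n : ℕ∞} : ContDiff ℝ n (timeCore d l) :=
  (contDiff_timeBump 1 (-2) 20).comp (by fun_prop)

lemma mem_of_mem_tsupport_timeCore {l : ℝ} {y : Fin (d + 1) → ℝ} (hl : 0 < l)
    (hy : y ∈ tsupport (timeCore d l)) : -2 * l ^ 2 ≤ y 0 ∧ y 0 ≤ 21 * l ^ 2 := by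
  have hl2 : 0 < l ^ 2 := by positivity
  refine tsupport_subset_of_ne_zero
    (s := {y : Fin (d + 1) → ℝ | -2 * l ^ 2 ≤ y 0 ∧ y 0 ≤ 21 * l ^ 2})
    ((isClosed_le continuous_const (continuous_apply 0)).inter
      (isClosed_le (continuous_apply 0) continuous_const)) (fun y hy => ?_) hy
  by_contra h
  refine hy (timeBump_eq_zero ?_)
  simp only [Set.mem_ofPred_eq, not_and_or, not_le] at h
  rcases h with h | h
  · left
    have : y 0 / l ^ 2 < -2 := by rwa [div_lt_iff₀ hl2]
    constructor <;> linarith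
  · right
    have : 21 < y 0 / l ^ 2 := by rwa [lt_div_iff₀ hl2]
    constructor <;> linarith

lemma IsPunctured.map_eq_add (h : IsPunctured d r p ν T ξ K) (hη : LinOn d r (S1 d T) η)
    (hext : ∀ φ, IsTest d r (S0 d T) φ → η φ = ξ φ) {φ : (Fin (d + 1) → ℝ) → ℝ}
    (hφ : IsTest d r (S1 d T) φ) {l : ℝ} (hl : 0 < l) :
    η φ = ξ (φ * timeCut d l) + η (φ * timeCore d l) := by
  have h1 : IsTest d r (S1 d T) (φ * timeCut d l) := hφ.mul_right contDiff_timeCut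
  have h2 : IsTest d r (S1 d T) (φ * timeCore d l) := hφ.mul_right contDiff_timeCore
  obtain ⟨h3, h4⟩ := hη.map_sub hφ (h1.add h2)
  have h5 : ∀ y ∈ tsupport (φ - (φ * timeCut d l + φ * timeCore d l)), y 0 < 0 := by
    have hl2 : 0 < l ^ 2 := by positivity
    intro y hy
    have : y ∈ {y : Fin (d + 1) → ℝ | y 0 ≤ -l ^ 2} := by
      refine tsupport_subset_of_ne_zero (isClosed_le (continuous_apply 0) continuous_const)
        (fun y hy => ?_) hy
      by_contra hy0
      refine hy ?_
      have h6 : 1 ≤ 1 * (y 0 / l ^ 2) - -2 := by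
        have : -1 < y 0 / l ^ 2 := by
          rw [lt_div_iff₀ hl2]
          have : -l ^ 2 < y 0 := not_le.1 hy0
          linarith
        linarith
      simp only [Pi.sub_apply, Pi.add_apply, Pi.mul_apply, timeCut, timeCore, timeBump,
        Real.smoothTransition.one_of_one_le h6]
      ring
    have h7 : y 0 ≤ -l ^ 2 := this
    linarith
  have h6 : IsTest d r (S0 d T) (φ - (φ * timeCut d l + φ * timeCore d l)) :=
    h3.mono fun y hy => Or.inl (h5 y hy)
  have h7 := h.eq_zero _ h6 h5
  rw [← hext _ h6] at h7
  rw [h7, hη.1 _ _ h1 h2, hext _ (hφ.mul_timeCut hl)] at h4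
  linarith

lemma IsPunctured.eq_cutExtension (h : IsPunctured d r p ν T ξ K) (hl : 0 < lam)
    (hlam1 : lam ≤ 1) (hlam : 23 * lam ^ 2 < T) (hη : LinOn d r (S1 d T) η)
    (hext : ∀ φ, IsTest d r (S0 d T) φ → η φ = ξ φ) (hper : PeriodicOn d r (S1 d T) η)
    (hL : L ≠ ⊤) (hb : ∀ l : ℝ, 0 < l → l ≤ 1 →
      lpE d (volume.restrict (strip d (Set.Iio (T - l ^ 2)))) p (supBr d r η l)
        ≤ L * ENNReal.ofReal (l ^ ν))
    {φ : (Fin (d + 1) → ℝ) → ℝ} (hφ : IsTest d r (S1 d T) φ) :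
    η φ = cutExtension d ξ lam φ := by
  obtain ⟨N, hN1, hN⟩ := exists_forall_abs_add_le hφ.2.1
  obtain ⟨A, hA, hφb⟩ := exists_derivBound hφ.1 hφ.2.1
  obtain ⟨B, hB, hBb⟩ := exists_derivBound_timeBump d r (show (0 : ℝ) < 1 by norm_num) (-2) 20
  obtain ⟨C, hC, hslab⟩ := exists_slab_bound d r
  have hq : 0 ≤ 1 - p⁻¹.toReal := sub_nonneg.2 (inv_toReal_le_one h.one_le)
  set γ := 2 * (1 - p⁻¹.toReal) + ν
  have hγ : 0 < γ := h.pos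
  set D : ENNReal := ENNReal.ofReal (C * (2 ^ r * (A * B))) * ((2 * N) ^ d * L *
    (ENNReal.ofReal 25 * (2 * N) ^ d) ^ (1 - p⁻¹.toReal))
  have hD : D ≠ ⊤ := by finiteness
  have hcore : ∀ m, 0 < m → m ≤ lam → |η (φ * timeCore d m)| ≤ D.toReal * m ^ γ := by
    intro m hm hmlam
    have hm1 := hmlam.trans hlam1
    have hm2 : m ^ 2 ≤ lam ^ 2 := by gcongr
    have hJ : Set.Icc (-3 * m ^ 2) (22 * m ^ 2) ⊆ Set.Iio (T - m ^ 2) := fun t ht => by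
      rw [Set.mem_Iio]
      linarith [ht.2]
    have h1 := hslab p h.one_le (S1 d T) η hη _ (hφ.mul_right contDiff_timeCore) m _ hm
      (by positivity) ((hφb.mono_scale hm.le hm1).mul hm (hBb m hm) hφ.1 contDiff_timeCore)
      (Set.Icc (-3 * m ^ 2) (22 * m ^ 2)) N measurableSet_Icc hN1
      ((hper.periodicAt_S1 hm).mono hJ) fun y hy z hz => ?_
    · have h3 : lpE d (volume.restrict (strip d (Set.Icc (-3 * m ^ 2) (22 * m ^ 2)))) p
          (supBr d r η m) ≤ L * ENNReal.ofReal (m ^ ν) := by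
        refine (lpE_mono_measure (Measure.restrict_mono ?_ le_rfl)).trans (hb m hm hm1)
        exact fun z hz => ⟨hJ hz.1, hz.2⟩
      have h4 : (22 * m ^ 2 - -3 * m ^ 2) = 25 * m ^ 2 := by ring
      rw [Real.volume_Icc, h4] at h1
      rw [← ENNReal.ofReal_le_ofReal_iff (by positivity), ENNReal.ofReal_mul (by positivity),
        ENNReal.ofReal_toReal hD]
      calc _ ≤ ENNReal.ofReal (C * (2 ^ r * (A * B))) *
            ((2 * N) ^ d * (L * ENNReal.ofReal (m ^ ν))
            * (ENNReal.ofReal (25 * m ^ 2) * (2 * N) ^ d) ^ (1 - p⁻¹.toReal)) :=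
            h1.trans (by gcongr)
        _ = ENNReal.ofReal (C * (2 ^ r * (A * B))) * ((2 * N) ^ d * L * (ENNReal.ofReal (m ^ ν)
            * (ENNReal.ofReal (25 * m ^ 2) * (2 * N) ^ d) ^ (1 - p⁻¹.toReal))) := by ring
        _ = _ := by
            rw [ofReal_rpow_mul_rpow (by norm_num) hm hq]
            ring
    · have h1 := mem_of_mem_tsupport_timeCore hm (tsupport_mul_subset_right hy)
      have h2 := abs_le.1 (hz 0)
      rw [sE_zero] at h2
      refine ⟨⟨by linarith [h2.1, h2.2], by linarith [h2.1, h2.2]⟩, fun i => ?_⟩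
      have h3 := hN y (tsupport_mul_subset_left hy) i.succ
      have h4 := abs_le.1 (hz i.succ)
      rw [sE_succ, pow_one] at h4
      have h5 := neg_abs_le (y i.succ)
      have h6 := le_abs_self (y i.succ)
      constructor <;> linarith [h4.1, h4.2]
  have hlim : Tendsto (fun n : ℕ => η (φ * timeCore d (lam / 2 ^ n))) atTop (𝓝 0) := by
    refine squeeze_zero_norm (a := fun n : ℕ => D.toReal * (lam ^ γ * ((2 : ℝ) ^ (-γ)) ^ n))
      (fun n => ?_) ?_
    · rw [← div_two_pow_rpow hl]
      exact hcore _ (by positivity) (div_two_pow_le hl n)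
    · have h1 := tendsto_pow_atTop_nhds_zero_of_lt_one (show (0 : ℝ) ≤ 2 ^ (-γ) by positivity)
        (Real.rpow_lt_one_of_one_lt_of_neg (by norm_num) (by linarith))
      have h2 := (h1.const_mul (lam ^ γ)).const_mul D.toReal
      simpa using h2
  have h1 := (h.tendsto_cutExtension hl hlam1 hlam hφ).add hlim
  rw [add_zero] at h1
  refine tendsto_nhds_unique (tendsto_const_nhds.congr fun n => ?_) h1
  exact h.map_eq_add hη hext hφ (by positivity)

end Uniqueness

section SmallScales

variable {d r : ℕ} {p : ENNReal} {ν T : ℝ} {ξ : ((Fin (d + 1) → ℝ) → ℝ) → ℝ} {K : ENNReal}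
  {lam : ℝ}

lemma strip_mono {J J' : Set ℝ} (h : J ⊆ J') : strip d J ⊆ strip d J' := fun _ hz => ⟨h hz.1, hz.2⟩

lemma lpE_restrict_union_le (hp : 1 ≤ p) (s t : Set (Fin (d + 1) → ℝ))
    (g : (Fin (d + 1) → ℝ) → ENNReal) :
    lpE d (volume.restrict (s ∪ t)) p g
      ≤ lpE d (volume.restrict s) p g + lpE d (volume.restrict t) p g := by
  refine (lpE_mono_measure (Measure.restrict_union_le s t)).trans ?_
  by_cases h : p = ⊤
  · subst h
    simp only [lpE_top]
    refine essSup_le_of_ae_le _ ?_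
    rw [EventuallyLE, ae_add_measure_iff]
    constructor
    · filter_upwards [ENNReal.ae_le_essSup g] with z hz using hz.trans le_self_add
    · filter_upwards [ENNReal.ae_le_essSup g] with z hz using hz.trans le_add_self
  · have h0 : 0 < p.toReal := ENNReal.toReal_pos (by positivity) h
    have h1 : 1 ≤ p.toReal := by
      rw [← ENNReal.toReal_one]; exact ENNReal.toReal_mono h hp
    simp only [lpE_of_ne_top h, lintegral_add_measure]
    exact ENNReal.rpow_add_le_add_rpow _ _ (by positivity) (by rwa [div_le_one h0])

lemma lpE_eq_zero_of_ae (hp : 1 ≤ p) {μ : Measure (Fin (d + 1) → ℝ)}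
    {g : (Fin (d + 1) → ℝ) → ENNReal} (hg : ∀ᵐ z ∂μ, g z = 0) : lpE d μ p g = 0 := by
  have h1 : lpE d μ p g ≤ lpE d μ p 0 := lpE_mono_ae (hg.mono fun z hz => hz.le)
  rw [lpE_eq_eLpNorm hp 0, eLpNorm_zero] at h1
  exact le_antisymm h1 zero_le

lemma column_constant {C l m q : ℝ} (hC : 0 < C) (hl : 0 < l) (hm : 0 < m) (hq0 : 0 ≤ q)
    (hq1 : q ≤ 1) (K : ENNReal) :
    ENNReal.ofReal (C * (l ^ (d + 2))⁻¹) *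
      ((ENNReal.ofReal (18 * m ^ 2) * ENNReal.ofReal (4 * l) ^ d) ^ (1 - q)
        * (ENNReal.ofReal (4 * l ^ 2) * ENNReal.ofReal (4 * l) ^ d) ^ q
        * (6 ^ d * (K * ENNReal.ofReal (m ^ ν))))
      = ENNReal.ofReal (C * 4 ^ d * 18 ^ (1 - q) * 4 ^ q) * 6 ^ d * K
        * ENNReal.ofReal (m ^ (2 * (1 - q) + ν) * l ^ (-(2 * (1 - q)))) := by
  have hq : 0 ≤ 1 - q := sub_nonneg.2 hq1
  have hreal : C * (l ^ (d + 2))⁻¹ * (18 * m ^ 2 * (4 * l) ^ d) ^ (1 - q)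
      * (4 * l ^ 2 * (4 * l) ^ d) ^ q * m ^ ν
      = C * 4 ^ d * 18 ^ (1 - q) * 4 ^ q
        * (m ^ (2 * (1 - q) + ν) * l ^ (-(2 * (1 - q)))) := by
    have e1 : ((4 * l) ^ d) ^ (1 - q) * ((4 * l) ^ d) ^ q = 4 ^ d * l ^ d := by
      rw [← Real.rpow_add (by positivity), sub_add_cancel, Real.rpow_one, mul_pow]
    have e2 : (m ^ 2) ^ (1 - q) * m ^ ν = m ^ (2 * (1 - q) + ν) := by
      rw [← Real.rpow_natCast, ← Real.rpow_mul hm.le, ← Real.rpow_add hm]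
      norm_num
    have e3 : (l ^ (d + 2))⁻¹ * (l ^ d * (l ^ 2) ^ q) = l ^ (-(2 * (1 - q))) := by
      rw [show -(2 * (1 - q)) = 2 * q - 2 by ring, Real.rpow_sub hl, Real.rpow_mul hl.le,
        pow_add]
      norm_num
      field_simp
    rw [Real.mul_rpow (by positivity) (by positivity), Real.mul_rpow (by positivity) (by positivity),
      Real.mul_rpow (by positivity) (by positivity), Real.mul_rpow (by positivity) (by positivity),
      ← e2, ← e3]
    linear_combination (C * (l ^ (d + 2))⁻¹ * 18 ^ (1 - q) * (m ^ 2) ^ (1 - q) * 4 ^ q * (l ^ 2) ^ q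
      * m ^ ν) * e1
  rw [← ENNReal.ofReal_pow (by positivity), ← ENNReal.ofReal_mul (by positivity),
    ← ENNReal.ofReal_mul (by positivity), ENNReal.ofReal_rpow_of_nonneg (by positivity) hq,
    ENNReal.ofReal_rpow_of_nonneg (by positivity) hq0]
  calc _ = (ENNReal.ofReal (C * (l ^ (d + 2))⁻¹)
        * ENNReal.ofReal ((18 * m ^ 2 * (4 * l) ^ d) ^ (1 - q))
        * ENNReal.ofReal ((4 * l ^ 2 * (4 * l) ^ d) ^ q) * ENNReal.ofReal (m ^ ν))
        * (6 ^ d * K) := by ring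
    _ = (ENNReal.ofReal (C * 4 ^ d * 18 ^ (1 - q) * 4 ^ q)
        * ENNReal.ofReal (m ^ (2 * (1 - q) + ν) * l ^ (-(2 * (1 - q))))) * (6 ^ d * K) := by
        rw [← ENNReal.ofReal_mul (by positivity), ← ENNReal.ofReal_mul (by positivity),
          ← ENNReal.ofReal_mul (by positivity), ← ENNReal.ofReal_mul (by positivity), hreal]
    _ = _ := by ring

lemma tsum_ofReal_layers {l γ : ℝ} (hl : 0 < l) (hγ : 0 < γ) (hlam : 0 < lam) (hlam_le : lam ≤ l)
    (b : ℝ) : ∑' k : ℕ, ENNReal.ofReal ((lam / 2 ^ k) ^ γ * l ^ b)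
      ≤ ENNReal.ofReal ((1 - 2 ^ (-γ))⁻¹ * l ^ (γ + b)) := by
  have h2 : (2 : ℝ) ^ (-γ) < 1 := Real.rpow_lt_one_of_one_lt_of_neg (by norm_num) (by linarith)
  have h3 := (hasSum_geometric_of_lt_one (by positivity) h2).mul_left (lam ^ γ * l ^ b)
  have h4 : ∀ k : ℕ, (lam / 2 ^ k) ^ γ * l ^ b = lam ^ γ * l ^ b * ((2 : ℝ) ^ (-γ)) ^ k :=
    fun k => by rw [div_two_pow_rpow hlam]; ring
  simp only [h4]
  rw [← ENNReal.ofReal_tsum_of_nonneg (fun k => by positivity) h3.summable, h3.tsum_eq,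
    Real.rpow_add hl]
  refine ENNReal.ofReal_le_ofReal ?_
  have h5 : lam ^ γ ≤ l ^ γ := Real.rpow_le_rpow hlam.le hlam_le hγ.le
  have h6 : 0 < (1 - (2 : ℝ) ^ (-γ))⁻¹ := inv_pos.2 (by linarith)
  have h7 : 0 < l ^ b := Real.rpow_pos_of_pos hl _
  calc lam ^ γ * l ^ b * (1 - 2 ^ (-γ))⁻¹ ≤ l ^ γ * l ^ b * (1 - 2 ^ (-γ))⁻¹ := by gcongr
    _ = _ := by ring

lemma isTest_testScale_S1 {φ : (Fin (d + 1) → ℝ) → ℝ} (hφ : φ ∈ BrSet d r) {l : ℝ} (hl : 0 < l)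
    {z : Fin (d + 1) → ℝ} (hz : z 0 < T - l ^ 2) : IsTest d r (S1 d T) (testScale d l z φ) :=
  isTest_testScale hl hφ fun y hy => by
    have h := abs_le.1 (hy 0)
    rw [sE_zero] at h
    show y 0 < T
    linarith [h.2]

lemma IsPunctured.exists_middle_bound (h : IsPunctured d r p ν T ξ K) (hl0 : 0 < lam)
    (hlam1 : lam ≤ 1) (hlam : 23 * lam ^ 2 < T) : ∃ L : ENNReal, L ≠ ⊤ ∧
      ∀ l : ℝ, 0 < l → l ≤ lam →
        lpE d (volume.restrict (strip d (Set.Icc (-l ^ 2) (3 * l ^ 2)))) p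
          (supBr d r (cutExtension d ξ lam) l) ≤ L * ENNReal.ofReal (l ^ ν) := by
  obtain ⟨C, hC, hlayer⟩ := _root_.exists_layer_bound d r
  have hq0 : 0 ≤ p⁻¹.toReal := ENNReal.toReal_nonneg
  have hq1 := inv_toReal_le_one h.one_le
  have hγ := h.pos
  set q := p⁻¹.toReal
  have hK := h.ne_top
  refine ⟨ENNReal.ofReal (C * 4 ^ d * 18 ^ (1 - q) * 4 ^ q) * 6 ^ d * K
    * ENNReal.ofReal (1 - 2 ^ (-(2 * (1 - q) + ν)))⁻¹, by finiteness, fun l hl hllam => ?_⟩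
  have hl1 := hllam.trans hlam1
  have hl2 : l ^ 2 ≤ lam ^ 2 := by gcongr
  have hl2' : 0 < l ^ 2 := by positivity
  obtain ⟨n, hn1, hn2⟩ := exists_nat_pow_near_of_lt_one (x := l / lam) (y := 1 / 2) (by positivity)
    (by rwa [div_le_one hl0]) (by norm_num) (by norm_num)
  set μ := lam / 2 ^ (n + 1) with hμ
  have hμ0 : 0 < μ := by positivity
  have hμl : μ ≤ l := by
    rw [lt_div_iff₀ hl0] at hn1
    rw [hμ, div_eq_mul_inv, mul_comm, ← inv_pow, ← one_div]
    exact hn1.le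
  have hlμ : l ≤ 2 * μ := by
    rw [div_le_iff₀ hl0] at hn2
    refine hn2.trans_eq ?_
    rw [hμ, one_div, inv_pow, pow_succ]
    field_simp
  have hm0 : ∀ k : ℕ, 0 < μ / 2 ^ k := fun k => by positivity
  have hml : ∀ k : ℕ, μ / 2 ^ k ≤ l := fun k => (div_two_pow_le hμ0 k).trans hμl
  have hmlam : ∀ k : ℕ, μ / 2 ^ k ≤ lam := fun k => (hml k).trans hllam
  choose a ha_meas ha_eq ha_le using fun k : ℕ =>
    exists_columnIntegral (d := d) h.one_le
      (measurableSet_Icc (a := 4 * (μ / 2 ^ k) ^ 2) (b := 22 * (μ / 2 ^ k) ^ 2))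
      (measurableSet_Icc (a := -l ^ 2) (b := 3 * l ^ 2))
      ((h.periodicOn.periodicAt_S0 (hm0 k)).mono (layer_subset (hm0 k) hlam (hmlam k))) hl1
  have hpoint : ∀ z ∈ strip d (Set.Icc (-l ^ 2) (3 * l ^ 2)),
      supBr d r (cutExtension d ξ lam) l z
        ≤ ∑' k, ENNReal.ofReal (C * (l ^ (d + 2))⁻¹) * a k z := by
    intro z hz
    have hz1 : z 0 ≤ 3 * l ^ 2 := hz.1.2
    refine iSup₂_le fun φ hφ => ?_
    have htest := isTest_testScale_S1 (T := T) hφ hl (z := z) (by linarith)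
    have hnear := tsupport_testScale (z := z) hl hφ
    refine (h.ofReal_abs_cutExtension_le hl0 hlam1 hlam htest (n + 1)).trans ?_
    have hzero : testScale d l z φ * timeCut d (lam / 2 ^ (n + 1)) = 0 := by
      ext y
      by_cases hy : y ∈ tsupport (testScale d l z φ)
      · have h1 := (abs_le.1 (hnear y hy 0)).2
        rw [sE_zero] at h1
        have h2 : l ^ 2 ≤ (2 * μ) ^ 2 := by gcongr
        have : timeCut d (lam / 2 ^ (n + 1)) y = 0 :=
          timeCut_eq_zero hμ0 (by rw [← hμ]; nlinarith)
        simp [this]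
      · simp [image_eq_zero_of_notMem_tsupport hy]
    rw [hzero, h.linOn.map_zero, abs_zero, ENNReal.ofReal_zero, zero_add]
    refine ENNReal.tsum_le_tsum fun k => ?_
    have hk : lam / 2 ^ (n + 1 + k) = μ / 2 ^ k := by rw [hμ, div_div, ← pow_add]
    rw [hk, ← ha_eq]
    refine hlayer T ξ h.linOn _ htest l _ _ (hm0 k) (hml k) (by positivity)
      (derivBound_testScale hl hφ) _ fun y hy w hw hyw => ⟨hw, fun i => ?_⟩
    have h1 := hyw i.succ
    have h2 := hnear y hy i.succ
    rw [sE_succ, pow_one] at h1 h2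
    rw [abs_le] at h1 h2 ⊢
    have := hml k
    constructor <;> linarith [h1.1, h1.2, h2.1, h2.2]
  have hmeas : MeasurableSet (strip d (Set.Icc (-l ^ 2) (3 * l ^ 2))) :=
    measurableSet_strip measurableSet_Icc
  refine (lpE_mono_ae ((ae_restrict_iff' hmeas).2 (Eventually.of_forall hpoint))).trans ?_
  refine (lpE_tsum_le h.one_le fun k => (ha_meas k).const_mul _).trans ?_
  calc _ ≤ ∑' k, ENNReal.ofReal (C * 4 ^ d * 18 ^ (1 - q) * 4 ^ q) * 6 ^ d * K
        * ENNReal.ofReal ((μ / 2 ^ k) ^ (2 * (1 - q) + ν) * l ^ (-(2 * (1 - q)))) := by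
        refine ENNReal.tsum_le_tsum fun k => ?_
        rw [lpE_const_mul h.one_le (by finiteness), ← column_constant hC hl (hm0 k) hq0 hq1 K]
        gcongr
        refine (ha_le k).trans ?_
        rw [Real.volume_Icc, Real.volume_Icc]
        gcongr
        · linarith
        · linarith
        · exact (lpE_mono_measure (Measure.restrict_mono
            (strip_mono (layer_subset (hm0 k) hlam (hmlam k))) le_rfl)).trans
            (h.bound _ (hm0 k) ((hml k).trans hl1))
    _ ≤ ENNReal.ofReal (C * 4 ^ d * 18 ^ (1 - q) * 4 ^ q) * 6 ^ d * K
        * ENNReal.ofReal ((1 - 2 ^ (-(2 * (1 - q) + ν)))⁻¹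
          * l ^ (2 * (1 - q) + ν + -(2 * (1 - q)))) := by
        rw [ENNReal.tsum_mul_left]
        gcongr
        exact tsum_ofReal_layers hl hγ hμ0 hμl _
    _ = _ := by
        have h2 : (2 : ℝ) ^ (-(2 * (1 - q) + ν)) < 1 :=
          Real.rpow_lt_one_of_one_lt_of_neg (by norm_num) (by linarith)
        rw [ENNReal.ofReal_mul (inv_nonneg.2 (by linarith)), add_neg_cancel_comm]
        ring

lemma IsPunctured.exists_small_scale_bound (h : IsPunctured d r p ν T ξ K) (hl0 : 0 < lam)
    (hlam1 : lam ≤ 1) (hlam : 23 * lam ^ 2 < T) : ∃ L : ENNReal, L ≠ ⊤ ∧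
      ∀ l : ℝ, 0 < l → l ≤ lam →
        lpE d (volume.restrict (strip d (Set.Iio (T - l ^ 2)))) p
          (supBr d r (cutExtension d ξ lam) l) ≤ L * ENNReal.ofReal (l ^ ν) := by
  obtain ⟨L, hL, hmid⟩ := h.exists_middle_bound hl0 hlam1 hlam
  have hK := h.ne_top
  refine ⟨L + K, by finiteness, fun l hl hllam => ?_⟩
  have hl1 := hllam.trans hlam1
  have hl2' : 0 < l ^ 2 := by positivity
  have hsub : strip d (Set.Iio (T - l ^ 2)) ⊆ strip d (Set.Iio (-l ^ 2)) ∪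
      (strip d (Set.Icc (-l ^ 2) (3 * l ^ 2)) ∪ strip d (Set.Ioo (3 * l ^ 2) (T - l ^ 2))) := by
    intro z hz
    rcases lt_or_ge (z 0) (-l ^ 2) with h1 | h1
    · exact Or.inl ⟨h1, hz.2⟩
    · rcases le_or_gt (z 0) (3 * l ^ 2) with h2 | h2
      · exact Or.inr (Or.inl ⟨⟨h1, h2⟩, hz.2⟩)
      · exact Or.inr (Or.inr ⟨⟨h2, hz.1⟩, hz.2⟩)
  refine (lpE_mono_measure (Measure.restrict_mono hsub le_rfl)).trans ?_
  refine (lpE_restrict_union_le h.one_le _ _ _).trans ?_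
  have hneg : lpE d (volume.restrict (strip d (Set.Iio (-l ^ 2)))) p
      (supBr d r (cutExtension d ξ lam) l) = 0 := by
    refine lpE_eq_zero_of_ae h.one_le ((ae_restrict_iff' (measurableSet_strip
      measurableSet_Iio)).2 (Eventually.of_forall fun z hz => ?_))
    refine le_antisymm (iSup₂_le fun φ hφ => ?_) zero_le
    rw [h.cutExtension_eq_zero hl0 fun y hy => ?_, abs_zero, ENNReal.ofReal_zero]
    have h1 := (abs_le.1 (tsupport_testScale hl hφ y hy 0)).2
    have h2 : z 0 < -l ^ 2 := hz.1
    rw [sE_zero] at h1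
    linarith
  rw [hneg, zero_add, add_mul]
  refine (lpE_restrict_union_le h.one_le _ _ _).trans (add_le_add (hmid l hl hllam) ?_)
  refine le_trans (lpE_mono_ae ((ae_restrict_iff' (measurableSet_strip
    measurableSet_Ioo)).2 (Eventually.of_forall fun z hz => ?_))) (h.bound l hl hl1)
  refine iSup₂_le fun φ hφ => ?_
  rw [h.cutExtension_eq hl0]
  · exact le_iSup₂ (f := fun φ (_ : φ ∈ BrSet d r) => ENNReal.ofReal |ξ (testScale d l z φ)|) φ hφ
  · refine isTest_testScale hl hφ fun y hy => ?_
    have h1 := abs_le.1 (hy 0)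
    rw [sE_zero] at h1
    have h2 : 3 * l ^ 2 < z 0 := hz.1.1
    have h3 : z 0 < T - l ^ 2 := hz.1.2
    exact Or.inr ⟨by linarith [h1.1], by linarith [h1.2]⟩

end SmallScales

section Semicontinuity

variable {d r : ℕ} {p : ENNReal} {T : ℝ} {η : ((Fin (d + 1) → ℝ) → ℝ) → ℝ} {lam : ℝ}

lemma eventually_derivBound_sub {f : (Fin (d + 1) → ℝ) → ℝ} (hf : ContDiff ℝ (r : ℕ∞) f)
    (hc : HasCompactSupport f) {ε : ℝ} (hε : 0 < ε) :
    ∀ᶠ v in 𝓝 (0 : Fin (d + 1) → ℝ), DerivBound d r 1 ε ((fun y => f (y - v)) - f) := by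
  have h1 : ∀ w ∈ {w : List (Fin (d + 1)) | wordWeight d w < r},
      ∀ᶠ v in 𝓝 (0 : Fin (d + 1) → ℝ), ∀ y, |wordDeriv d w f (y - v) - wordDeriv d w f y| ≤ ε := by
    intro w hw
    have h2 := (hasCompactSupport_wordDeriv w hc).uniformContinuous_of_continuous
      (continuous_wordDeriv hf hw)
    obtain ⟨δ, hδ, h3⟩ := Metric.uniformContinuous_iff.1 h2 ε hε
    filter_upwards [Metric.ball_mem_nhds 0 hδ] with v hv y
    rw [← Real.dist_eq]
    refine (h3 ?_).le
    rw [dist_eq_norm, sub_sub_cancel_left, norm_neg]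
    simpa using hv
  filter_upwards [(eventually_all_finite (finite_wordWeight_lt d r)).2 h1] with v hv w _ hw y
  have hlen : ContDiff ℝ (w.length : ℕ∞) f :=
    hf.of_le (by exact_mod_cast (length_le_wordWeight d w).trans hw.le)
  have h2 : (fun y => f (y - v)) = fun y => f (-v + sclE d 1 y) := by
    ext y; rw [sclE_one, neg_add_eq_sub]
  have h3 : ((fun y => f (y - v)) - f) = (fun y => f (y - v)) + fun y => (-1 : ℝ) * f y := by
    ext y; simp [sub_eq_add_neg]
  have h4 : ContDiff ℝ (w.length : ℕ∞) fun y => f (y - v) :=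
    hlen.comp (contDiff_id.sub contDiff_const)
  rw [h3, wordDeriv_add w h4 (contDiff_const.mul hlen), wordDeriv_const_mul w _ hlen, h2, wordDeriv_comp_affine w _ _ hlen]
  simpa [sclE_one, neg_add_eq_sub, ← sub_eq_add_neg] using hv w hw y

lemma tendsto_map_comp_sub (hp : 1 ≤ p) (hη : LinOn d r (S1 d T) η)
    (hper : PeriodicOn d r (S1 d T) η) (hl0 : 0 < lam) (hlam1 : lam ≤ 1)
    (hb : ∀ l : ℝ, 0 < l → l ≤ lam →
      lpE d (volume.restrict (strip d (Set.Iio (T - l ^ 2)))) p (supBr d r η l) ≠ ⊤)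
    {f : (Fin (d + 1) → ℝ) → ℝ} (hf : IsTest d r (S1 d T) f) {δ : ℝ} (hδ : 0 < δ)
    (hfδ : ∀ y ∈ tsupport f, y 0 + 3 * δ ≤ T) :
    Tendsto (fun v => η fun y => f (y - v)) (𝓝 0) (𝓝 (η f)) := by
  obtain ⟨N, hN1, hN⟩ := exists_forall_abs_add_le hf.2.1
  obtain ⟨C, hC, hslab⟩ := exists_slab_bound d r
  obtain ⟨μ, hμ0, hμlam, hμδ⟩ : ∃ μ : ℝ, 0 < μ ∧ μ ≤ lam ∧ μ ^ 2 ≤ δ / 2 := by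
    refine ⟨min lam (δ / 2), by positivity, min_le_left _ _, ?_⟩
    have h1 := (min_le_left lam (δ / 2)).trans hlam1
    have h2 := min_le_right lam (δ / 2)
    have h3 : 0 < min lam (δ / 2) := by positivity
    nlinarith
  have hμ1 := hμlam.trans hlam1
  have hJ : Set.Icc (-N : ℝ) (T - δ) ⊆ Set.Iio (T - μ ^ 2) := fun t ht => by
    rw [Set.mem_Iio]; linarith [ht.2]
  have hq : 0 ≤ 1 - p⁻¹.toReal := sub_nonneg.2 (inv_toReal_le_one hp)
  set X : ENNReal := (2 * N) ^ d * lpE d (volume.restrict (strip d (Set.Icc (-N : ℝ) (T - δ)))) p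
    (supBr d r η μ) * (volume (Set.Icc (-N : ℝ) (T - δ)) * (2 * N) ^ d) ^ (1 - p⁻¹.toReal) with hX
  have hXt : X ≠ ⊤ := by
    have h1 : lpE d (volume.restrict (strip d (Set.Icc (-N : ℝ) (T - δ)))) p (supBr d r η μ) ≠ ⊤ :=
      ne_top_of_le_ne_top (hb μ hμ0 hμlam)
        (lpE_mono_measure (Measure.restrict_mono (strip_mono hJ) le_rfl))
    rw [hX, Real.volume_Icc]
    finiteness
  obtain ⟨x, hx0, hXx⟩ : ∃ x : ℝ, 0 ≤ x ∧ X = ENNReal.ofReal x :=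
    ⟨X.toReal, ENNReal.toReal_nonneg, (ENNReal.ofReal_toReal hXt).symm⟩
  rw [Metric.tendsto_nhds]
  intro ε hε
  have hε' : 0 < ε / (C * x + 1) := by positivity
  have hball : ∀ᶠ v in 𝓝 (0 : Fin (d + 1) → ℝ), ‖v‖ < min 1 δ := by
    filter_upwards [Metric.ball_mem_nhds 0 (show 0 < min 1 δ by positivity)] with v hv
    simpa using hv
  filter_upwards [eventually_derivBound_sub hf.1 hf.2.1 hε', hball] with v hv hvn
  have hvi : ∀ i, |v i| < 1 ∧ |v i| < δ := fun i => by
    have := (norm_le_pi_norm v i).trans_lt hvn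
    rw [Real.norm_eq_abs] at this
    exact lt_min_iff.1 this
  have htrans : ∀ y ∈ tsupport (fun y => f (y - v)), y - v ∈ tsupport f := fun y hy =>
    tsupport_comp_subset_preimage f (by fun_prop : Continuous fun y : Fin (d + 1) → ℝ => y - v) hy
  have hfv : IsTest d r (S1 d T) fun y => f (y - v) := by
    refine ⟨hf.1.comp (contDiff_id.sub contDiff_const),
      hf.2.1.comp_homeomorph (Homeomorph.subRight v), fun y hy => ?_⟩
    have h1 := hfδ _ (htrans y hy)
    have h2 := abs_lt.1 (hvi 0).2
    rw [Pi.sub_apply] at h1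
    show y 0 < T
    linarith [h2.2]
  obtain ⟨hsub, hsub_eq⟩ := hη.map_sub hfv hf
  have hbox : ∀ y ∈ tsupport ((fun y => f (y - v)) - f), (∀ i, |y i| + 1 < N) ∧ y 0 + 2 * δ ≤ T := by
    intro y hy
    rcases tsupport_sub _ _ hy with h1 | h1
    · have h2 := htrans y h1
      refine ⟨fun i => ?_, ?_⟩
      · have h3 := hN _ h2 i
        have h4 : |y i| ≤ |y i - v i| + |v i| := by
          have := abs_add_le (y i - v i) (v i)
          rwa [sub_add_cancel] at this
        rw [Pi.sub_apply] at h3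
        linarith [(hvi i).1]
      · have h3 := hfδ _ h2
        have h4 := abs_lt.1 (hvi 0).2
        rw [Pi.sub_apply] at h3
        linarith [h4.2]
    · exact ⟨fun i => by linarith [hN y h1 i], by linarith [hfδ y h1]⟩
  have h1 := hslab p hp (S1 d T) η hη _ hsub μ _ hμ0 hε' (hv.mono_scale hμ0.le hμ1)
    (Set.Icc (-N : ℝ) (T - δ)) N measurableSet_Icc hN1 ((hper.periodicAt_S1 hμ0).mono hJ)
    fun y hy z hz => by
      obtain ⟨h2, h3⟩ := hbox y hy
      have h4 := abs_le.1 (hz 0)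
      rw [sE_zero] at h4
      have h5 : μ ^ 2 ≤ 1 := pow_le_one₀ hμ0.le hμ1
      have h6 := h2 0
      have h7 := neg_abs_le (y 0)
      refine ⟨⟨by linarith [h4.1, h4.2], by linarith [h4.1, h4.2]⟩, fun i => ?_⟩
      have h8 := abs_le.1 (hz i.succ)
      rw [sE_succ, pow_one] at h8
      have h9 := h2 i.succ
      have h10 := neg_abs_le (y i.succ)
      have h11 := le_abs_self (y i.succ)
      constructor <;> linarith [h8.1, h8.2]
  rw [← hX, hXx, ← ENNReal.ofReal_mul (by positivity),
    ENNReal.ofReal_le_ofReal_iff (by positivity), hsub_eq] at h1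
  rw [Real.dist_eq]
  refine h1.trans_lt ?_
  have h2 : C * (ε / (C * x + 1)) * x = ε * (C * x / (C * x + 1)) := by
    ring
  have h3 : 0 ≤ C * x := by positivity
  rw [h2]
  refine mul_lt_of_lt_one_right hε ?_
  rw [div_lt_one (by positivity)]
  linarith

lemma measurable_indicator_supBr (hp : 1 ≤ p) (hη : LinOn d r (S1 d T) η)
    (hper : PeriodicOn d r (S1 d T) η) (hl0 : 0 < lam) (hlam1 : lam ≤ 1)
    (hb : ∀ l : ℝ, 0 < l → l ≤ lam →
      lpE d (volume.restrict (strip d (Set.Iio (T - l ^ 2)))) p (supBr d r η l) ≠ ⊤)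
    {l : ℝ} (hl : 0 < l) :
    Measurable ({z : Fin (d + 1) → ℝ | z 0 < T - l ^ 2}.indicator (supBr d r η l)) := by
  refine measurable_of_Ioi fun a => IsOpen.measurableSet ?_
  rw [isOpen_iff_mem_nhds]
  intro z hz
  have hz0 : z 0 < T - l ^ 2 := by
    by_contra h
    have : z ∉ {z : Fin (d + 1) → ℝ | z 0 < T - l ^ 2} := h
    simp [Set.indicator_of_notMem this] at hz
  have hza : a < supBr d r η l z := by
    have : z ∈ {z : Fin (d + 1) → ℝ | z 0 < T - l ^ 2} := hz0
    simpa [Set.indicator_of_mem this] using hz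
  obtain ⟨φ, hφ⟩ := lt_iSup_iff.1 hza
  obtain ⟨hφB, hφa⟩ := lt_iSup_iff.1 hφ
  have htest := isTest_testScale_S1 hφB hl hz0
  have h1 := tendsto_map_comp_sub hp hη hper hl0 hlam1 hb htest
    (δ := (T - l ^ 2 - z 0) / 3) (by linarith) fun y hy => by
      have := (abs_le.1 (tsupport_testScale hl hφB y hy 0)).2
      rw [sE_zero] at this
      linarith
  have h2 : ∀ v, (fun y => testScale d l z φ (y - v)) = testScale d l (z + v) φ := fun v => by
    ext y
    rw [testScale, testScale, sub_sub, add_comm v z]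
  simp only [h2] at h1
  have h3 : Tendsto (fun z' : Fin (d + 1) → ℝ => z' - z) (𝓝 z) (𝓝 0) := by
    have : Tendsto (fun z' : Fin (d + 1) → ℝ => z' - z) (𝓝 z) (𝓝 (z - z)) :=
      (continuous_id.sub continuous_const).tendsto z
    rwa [sub_self] at this
  have h4 : Tendsto (fun z' => ENNReal.ofReal |η (testScale d l z' φ)|) (𝓝 z)
      (𝓝 (ENNReal.ofReal |η (testScale d l z φ)|)) := by
    have := (ENNReal.continuous_ofReal.tendsto _).comp ((h1.comp h3).abs)
    simpa [Function.comp_def] using this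
  filter_upwards [h4.eventually (lt_mem_nhds hφa),
    (continuous_apply (0 : Fin (d + 1))).tendsto z (Iio_mem_nhds hz0)] with z' hz' hz'0
  have : z' ∈ {z : Fin (d + 1) → ℝ | z 0 < T - l ^ 2} := hz'0
  rw [Set.mem_preimage, Set.indicator_of_mem this]
  exact hz'.trans_le
    (le_iSup₂ (f := fun φ (_ : φ ∈ BrSet d r) => ENNReal.ofReal |η (testScale d l z' φ)|) φ hφB)

end Semicontinuity

section LargeScales

variable {d r : ℕ} {p : ENNReal} {ν T : ℝ} {ξ η : ((Fin (d + 1) → ℝ) → ℝ) → ℝ} {K L : ENNReal}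
  {lam : ℝ}

lemma testScale_testScale {l κ : ℝ} (hl : 0 < l) (z o : Fin (d + 1) → ℝ)
    (φ : (Fin (d + 1) → ℝ) → ℝ) :
    testScale d l z (testScale d κ o φ) = testScale d (κ * l) (z + sclE d l o) φ := by
  ext y
  have h1 : sclE d κ⁻¹ (sclE d l⁻¹ (y - z) - o) = sclE d (κ * l)⁻¹ (y - (z + sclE d l o)) := by
    rw [← sub_sub, sclE_sub _ (y - z), sclE_sub _ (sclE d l⁻¹ (y - z)), sclE_sclE, sclE_sclE,
      mul_inv, inv_mul_cancel_right₀ hl.ne']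
  simp only [testScale, h1, mul_pow, mul_inv]
  ring

lemma exists_rescale_bound (d r : ℕ) {κ : ℝ} (hκ : 0 < κ) (hκ1 : κ ≤ 1) :
    ∃ (C : ℝ) (s : Finset (Fin (d + 1) → ℕ)) (o : (Fin (d + 1) → ℕ) → Fin (d + 1) → ℝ) (N : ℕ),
      (∀ m ∈ s, o m 0 ≤ 1 - κ ^ 2 ∧ ∀ i : Fin d, |o m i.succ| ≤ N) ∧
      ∀ (T : ℝ) (η : ((Fin (d + 1) → ℝ) → ℝ) → ℝ), LinOn d r (S1 d T) η →
      ∀ l : ℝ, 0 < l → ∀ z : Fin (d + 1) → ℝ, z 0 < T - l ^ 2 →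
        supBr d r η l z
          ≤ ENNReal.ofReal C * ∑ m ∈ s, supBr d r η (κ * l) (z + sclE d l (o m)) := by
  obtain ⟨B, hB, hgrid⟩ := exists_derivBound_gridBump d r
  obtain ⟨N, hN⟩ := exists_nat_ge (2 / κ ^ 2 + 1)
  set A := 2 ^ r * (1 * B)
  have hA : 0 < A := by positivity
  set x : (Fin (d + 1) → ℕ) → Fin (d + 1) → ℝ := fun m i => (m i : ℝ) - N with hx
  set o : (Fin (d + 1) → ℕ) → Fin (d + 1) → ℝ := fun m =>
    Fin.cons (min (x m 0 * κ ^ 2 / 2) (1 - κ ^ 2)) fun i => x m i.succ * κ / 2 with ho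
  set s := Fintype.piFinset fun _ : Fin (d + 1) => Finset.range (2 * N)
  have hκ2 : ∀ i, κ ^ 2 ≤ κ ^ sE d i := fun i => by
    refine Fin.cases (by rw [sE_zero]) (fun j => ?_) i
    rw [sE_succ, pow_one]
    nlinarith
  have ho0 : ∀ m, o m 0 = min (x m 0 * κ ^ 2 / 2) (1 - κ ^ 2) := fun m => rfl
  have hos : ∀ m i, o m (Fin.succ i) = x m i.succ * κ / 2 := fun m i => rfl
  refine ⟨A * κ ^ (d + 2), s, o, N, fun m hm => ⟨?_, fun i => ?_⟩, ?_⟩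
  · rw [ho0]
    exact min_le_right _ _
  · have h1 := Finset.mem_range.1 (Fintype.mem_piFinset.1 hm i.succ)
    have h2 : (m i.succ : ℝ) ≤ 2 * N := by exact_mod_cast h1.le
    have h3 : |x m i.succ| ≤ N := by
      rw [hx, abs_le]
      constructor <;> linarith [Nat.cast_nonneg (α := ℝ) (m i.succ)]
    rw [hos, abs_div, abs_mul, abs_of_pos hκ, abs_of_pos (show (0 : ℝ) < 2 by norm_num)]
    have h4 : |x m i.succ| * κ ≤ N * 1 := by gcongr
    have h5 := abs_nonneg (x m i.succ)
    have h6 : 0 ≤ |x m i.succ| * κ := by positivity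
    linarith
  · intro T η hη l hl z hz
    refine iSup₂_le fun φ hφ => ?_
    obtain ⟨hφs, hφc, hφb⟩ := mem_BrSet_iff.1 hφ
    have hφN : ∀ y ∈ tsupport φ, ∀ i, |2 * y i / κ ^ sE d i| + 1 ≤ N := by
      intro y hy i
      have h1 : 0 < κ ^ sE d i := by positivity
      have h2 : |2 * y i / κ ^ sE d i| ≤ 2 / κ ^ 2 := by
        rw [abs_div, abs_mul, abs_of_pos h1, abs_of_pos (show (0 : ℝ) < 2 by norm_num)]
        have := hφs y hy i
        exact div_le_div₀ (by norm_num) (by linarith) (by positivity) (hκ2 i)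
      linarith
    have hpiece : ∀ m, ∃ ψ ∈ BrSet d r,
        φ * gridBump d κ (x m) = (A * κ ^ (d + 2)) • testScale d κ (o m) ψ := by
      intro m
      refine exists_eq_smul_testScale hκ hA (hφc.mul (contDiff_gridBump d κ _))
        ((hφb.mono_scale hκ.le hκ1).mul hκ (hgrid κ hκ _) hφc (contDiff_gridBump d κ _)) ?_
      intro y hy i
      have h1 := hφs y (tsupport_mul_subset_left hy)
      have h2 := abs_le_of_mem_tsupport_gridBump (tsupport_mul_subset_right hy) i
      have h3 : |y i - x m i * κ ^ sE d i / 2| ≤ κ ^ sE d i / 2 := by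
        have h4 : 0 < κ ^ sE d i := by positivity
        have h5 : y i - x m i * κ ^ sE d i / 2
            = (2 * y i / κ ^ sE d i - x m i) * (κ ^ sE d i / 2) := by field_simp
        rw [h5, abs_mul, abs_of_pos (show 0 < κ ^ sE d i / 2 by positivity)]
        exact mul_le_of_le_one_left (by positivity) h2
      revert h3
      refine Fin.cases (fun h3 => ?_) (fun j h3 => ?_) i
      · rw [sE_zero] at h3 ⊢
        rw [ho0]
        have h4 := abs_le.1 h3
        have h5 := (abs_le.1 (h1 0)).2
        have h6 : 0 < κ ^ 2 := by positivity
        rw [abs_le]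
        rcases min_cases (x m 0 * κ ^ 2 / 2) (1 - κ ^ 2) with ⟨h7, h8⟩ | ⟨h7, h8⟩ <;> rw [h7] <;>
          constructor <;> linarith [h4.1, h4.2]
      · rw [sE_succ, pow_one] at h3 ⊢
        rw [hos]
        linarith
    choose ψ hψ hψe using hpiece
    have hdecomp : testScale d l z φ
        = ∑ m ∈ s, (A * κ ^ (d + 2)) • testScale d (κ * l) (z + sclE d l (o m)) (ψ m) := by
      ext y
      rw [Finset.sum_apply]
      simp only [← testScale_testScale hl]
      simp only [testScale.eq_1 d l, Pi.smul_apply, smul_eq_mul]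
      rw [eq_sum_mul_gridBump hφN, Finset.sum_apply, Finset.mul_sum]
      refine Finset.sum_congr rfl fun m _ => ?_
      have := congrFun (hψe m) (sclE d l⁻¹ (y - z))
      simp only [Pi.smul_apply, smul_eq_mul] at this
      rw [this]
      ring
    have htest : ∀ m ∈ s, IsTest d r (S1 d T) (testScale d (κ * l) (z + sclE d l (o m)) (ψ m)) := by
      intro m _
      refine isTest_testScale_S1 (hψ m) (by positivity) ?_
      have h1 : o m 0 ≤ 1 - κ ^ 2 := by rw [ho0]; exact min_le_right _ _
      have h2 : l ^ 2 * o m 0 ≤ l ^ 2 * (1 - κ ^ 2) := by gcongr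
      rw [Pi.add_apply, sclE, sE_zero]
      nlinarith
    rw [hdecomp, (hη.map_sum s _ fun m hm => (htest m hm).smul _).2]
    refine (ENNReal.ofReal_le_ofReal (Finset.abs_sum_le_sum_abs _ _)).trans ?_
    rw [ENNReal.ofReal_sum_of_nonneg fun m _ => abs_nonneg _, Finset.mul_sum]
    refine Finset.sum_le_sum fun m hm => ?_
    rw [hη.2 _ _ (htest m hm), abs_mul, ENNReal.ofReal_mul (abs_nonneg _),
      abs_of_pos (by positivity)]
    gcongr
    exact le_iSup₂ (f := fun φ (_ : φ ∈ BrSet d r) =>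
      ENNReal.ofReal |η (testScale d (κ * l) (z + sclE d l (o m)) φ)|) (ψ m) (hψ m)

lemma lpE_comp_add_le (hp : 1 ≤ p) {g : (Fin (d + 1) → ℝ) → ENNReal} (hg : Measurable g)
    (v : Fin (d + 1) → ℝ) {s t : Set (Fin (d + 1) → ℝ)} (h : ∀ z ∈ s, z + v ∈ t) :
    lpE d (volume.restrict s) p (fun z => g (z + v)) ≤ lpE d (volume.restrict t) p g := by
  have h1 := (measurePreserving_add_right (volume : Measure (Fin (d + 1) → ℝ)) v).restrict_preimage_emb
    (MeasurableEquiv.addRight v).measurableEmbedding t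
  refine (lpE_mono_measure (Measure.restrict_mono (s' := (fun z => z + v) ⁻¹' t) h le_rfl)).trans ?_
  rw [lpE_eq_eLpNorm hp, lpE_eq_eLpNorm hp]
  exact (eLpNorm_comp_measurePreserving hg.aestronglyMeasurable h1).le

lemma lpE_large_scale_le (hp : 1 ≤ p) (hη : LinOn d r (S1 d T) η)
    (hper : PeriodicOn d r (S1 d T) η) (hl0 : 0 < lam) (hlam1 : lam ≤ 1) (hL : L ≠ ⊤)
    (hb : ∀ l : ℝ, 0 < l → l ≤ lam →
      lpE d (volume.restrict (strip d (Set.Iio (T - l ^ 2)))) p (supBr d r η l)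
        ≤ L * ENNReal.ofReal (l ^ ν)) :
    ∃ L' : ENNReal, L' ≠ ⊤ ∧ ∀ l : ℝ, 0 < l → l ≤ 1 →
      lpE d (volume.restrict (strip d (Set.Iio (T - l ^ 2)))) p (supBr d r η l)
        ≤ L' * ENNReal.ofReal (l ^ ν) := by
  obtain ⟨C, s, o, N, ho, hrescale⟩ := exists_rescale_bound d r hl0 hlam1
  have hb' : ∀ l : ℝ, 0 < l → l ≤ lam →
      lpE d (volume.restrict (strip d (Set.Iio (T - l ^ 2)))) p (supBr d r η l) ≠ ⊤ :=
    fun l hl hll => ne_top_of_le_ne_top (by finiteness) (hb l hl hll)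
  refine ⟨ENNReal.ofReal C * ∑ m ∈ s, (2 * (N + 1 : ℕ)) ^ d * L * ENNReal.ofReal (lam ^ ν),
    ENNReal.mul_ne_top (by finiteness) ((ENNReal.sum_lt_top.2 fun m _ => by finiteness).ne),
    fun l hl hl1 => ?_⟩
  have hm0 : 0 < lam * l := by positivity
  have hmlam : lam * l ≤ lam := mul_le_of_le_one_right hl0.le hl1
  set g := {z : Fin (d + 1) → ℝ | z 0 < T - (lam * l) ^ 2}.indicator (supBr d r η (lam * l))
  have hg : Measurable g := measurable_indicator_supBr hp hη hper hl0 hlam1 hb' hm0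
  have hshift : ∀ m ∈ s, ∀ z ∈ strip d (Set.Iio (T - l ^ 2)),
      z + sclE d l (o m) ∈ slab d (Set.Iio (T - (lam * l) ^ 2)) (N + 1) := by
    intro m hm z hz
    obtain ⟨h1, h2⟩ := ho m hm
    refine ⟨?_, fun i => ?_⟩
    · have h3 : z 0 < T - l ^ 2 := hz.1
      have h4 : l ^ 2 * o m 0 ≤ l ^ 2 * (1 - lam ^ 2) := by gcongr
      rw [Set.mem_Iio, Pi.add_apply, sclE, sE_zero]
      nlinarith
    · have h3 : |l * o m i.succ| ≤ N := by
        rw [abs_mul, abs_of_pos hl]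
        exact (mul_le_of_le_one_left (abs_nonneg _) hl1).trans (h2 i)
      have h4 := abs_le.1 h3
      have h5 := hz.2 i
      rw [Pi.add_apply, sclE, sE_succ, pow_one]
      push_cast
      constructor <;> linarith [h4.1, h4.2, h5.1, h5.2]
  have hmeas : MeasurableSet (strip d (Set.Iio (T - l ^ 2))) := measurableSet_strip measurableSet_Iio
  have hgslab : lpE d (volume.restrict (slab d (Set.Iio (T - (lam * l) ^ 2)) (N + 1))) p g
      ≤ (2 * (N + 1 : ℕ)) ^ d * (L * ENNReal.ofReal ((lam * l) ^ ν)) := by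
    refine (lpE_mono fun z => Set.indicator_le_self _ _ _).trans ?_
    refine (lpE_slab_le hp measurableSet_Iio (hper.periodicAt_S1 hm0) (by omega)).trans ?_
    gcongr
    exact hb _ hm0 hmlam
  calc _ ≤ lpE d (volume.restrict (strip d (Set.Iio (T - l ^ 2)))) p
        (fun z => ENNReal.ofReal C * ∑ m ∈ s, g (z + sclE d l (o m))) := by
        refine lpE_mono_ae ((ae_restrict_iff' hmeas).2 (Eventually.of_forall fun z hz => ?_))
        refine (hrescale T η hη l hl z hz.1).trans ?_
        gcongr with m hm
        have : z + sclE d l (o m) ∈ {z : Fin (d + 1) → ℝ | z 0 < T - (lam * l) ^ 2} :=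
          (hshift m hm z hz).1
        exact (Set.indicator_of_mem this _).ge
    _ ≤ ENNReal.ofReal C * ∑ m ∈ s, (2 * (N + 1 : ℕ)) ^ d * (L * ENNReal.ofReal ((lam * l) ^ ν)) := by
        rw [lpE_const_mul hp ENNReal.ofReal_ne_top]
        gcongr
        refine (lpE_sum_le hp s fun m _ => (hg.comp (measurable_add_const _)).aemeasurable).trans ?_
        exact Finset.sum_le_sum fun m hm => (lpE_comp_add_le hp hg _ (hshift m hm)).trans hgslab
    _ = _ := by
        rw [Real.mul_rpow hl0.le hl.le, ENNReal.ofReal_mul (by positivity), mul_assoc, Finset.sum_mul]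
        congr 1
        refine Finset.sum_congr rfl fun m _ => ?_
        ring

end LargeScales

/-- Lemma 5.11 of the paper, case ν < 0.  Let ν < 0 with
ν > -2(1 - 1/p).  Let ξ be a periodic distribution on test functions supported in
((-∞,0) ∪ (0,T)) × ℝ^d, vanishing on test functions supported in (-∞,0) × ℝ^d, and
satisfying the bound (5.2) with (-∞, T-λ²) replaced by (3λ², T-λ²).  Then ξ admits a
unique extension to test functions supported in (-∞,T) × ℝ^d belonging to 𝓑^(ν,T)_p. -/
theorem stmt7 (d : ℕ) (hd : 1 ≤ d) (T : ℝ) (hT : 0 < T)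
    (p : ENNReal) (hp : 1 ≤ p) (r : ℕ) (hr : 0 < r)
    (ν : ℝ) (hν : ν < 0) (hν' : -2 * (1 - 1 / p).toReal < ν)
    (ξ : ((Fin (d + 1) → ℝ) → ℝ) → ℝ)
    (hlin : LinOn d r (S0 d T) ξ)
    (hper : PeriodicOn d r (S0 d T) ξ)
    (hzero : ∀ φ, IsTest d r (S0 d T) φ → tsupport φ ⊆ {z | z 0 < 0} → ξ φ = 0)
    (hbdd : (⨆ l ∈ Set.Ioc (0 : ℝ) 1,
      bNorm d r p ν ξ l (Set.Ioo (3 * l ^ 2) (T - l ^ 2))) < ⊤) :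
    ∃ ξ' : ((Fin (d + 1) → ℝ) → ℝ) → ℝ,
      (LinOn d r (S1 d T) ξ' ∧
        (∀ φ, IsTest d r (S0 d T) φ → ξ' φ = ξ φ) ∧
        MemBnu d r p ν T ξ') ∧
      ∀ ξ'' : ((Fin (d + 1) → ℝ) → ℝ) → ℝ,
        (LinOn d r (S1 d T) ξ'' ∧
          (∀ φ, IsTest d r (S0 d T) φ → ξ'' φ = ξ φ) ∧
          MemBnu d r p ν T ξ'') →
        ∀ φ, IsTest d r (S1 d T) φ → ξ'' φ = ξ' φ := by
  have h : IsPunctured d r p ν T ξ (⨆ l ∈ Set.Ioc (0 : ℝ) 1,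
      bNorm d r p ν ξ l (Set.Ioo (3 * l ^ 2) (T - l ^ 2))) :=
    { one_le := hp
      pos := by
        rw [one_div, ENNReal.toReal_sub_of_le (ENNReal.inv_le_one.2 hp) ENNReal.one_ne_top,
          ENNReal.toReal_one] at hν'
        linarith
      linOn := hlin
      periodicOn := hper
      eq_zero := hzero
      ne_top := hbdd.ne
      bound := fun l hl hl1 => (bNorm_le_iff hp hl).1 (le_iSup₂ (f := fun l (_ : l ∈ Set.Ioc 0 1) =>
        bNorm d r p ν ξ l (Set.Ioo (3 * l ^ 2) (T - l ^ 2))) l ⟨hl, hl1⟩) }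
  obtain ⟨lam, hl0, hlam1, hlam⟩ : ∃ lam : ℝ, 0 < lam ∧ lam ≤ 1 ∧ 23 * lam ^ 2 < T := by
    refine ⟨min 1 (T / 24), by positivity, min_le_left _ _, ?_⟩
    have h1 := min_le_left 1 (T / 24)
    have h2 := min_le_right 1 (T / 24)
    have h3 : 0 < min 1 (T / 24) := by positivity
    nlinarith
  have hη := h.linOn_cutExtension hl0 hlam1 hlam
  have hηper := h.periodicOn_cutExtension hl0 hlam1 hlam
  refine ⟨cutExtension d ξ lam, ⟨hη, fun φ hφ => h.cutExtension_eq hl0 hφ, hηper, ?_⟩, ?_⟩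
  · obtain ⟨L, hL, hsmall⟩ := h.exists_small_scale_bound hl0 hlam1 hlam
    obtain ⟨L', hL', hbound⟩ := lpE_large_scale_le hp hη hηper hl0 hlam1 hL hsmall
    exact (iSup₂_le fun l hl => (bNorm_le_iff hp hl.1).2 (hbound l hl.1 hl.2)).trans_lt hL'.lt_top
  · rintro ξ'' ⟨hlin'', hext, hper'', hmem⟩ φ hφ
    exact h.eq_cutExtension hl0 hlam1 hlam hlin'' hext hper'' hmem.ne (fun l hl hl1 =>
      (bNorm_le_iff hp hl).1 (le_iSup₂ (f := fun l (_ : l ∈ Set.Ioc 0 1) =>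
        bNorm d r p ν ξ'' l (Set.Iio (T - l ^ 2))) l ⟨hl, hl1⟩)) hφ
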